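/- arXiv:1609.04717 — 5 statements merged into one kernel-verified Lean document; each statement's English description precedes it below -/
import Mathlib

section
/- Let M be an abelian group (regarded as discrete). The path component of the trivial character in the Pontryagin dual M^∨ is a subgroup of M^∨ (namely the image of Hom(M, ℝ) under composition with the projection ℝ → ℝ/ℤ), and the quotient group of M^∨ by this subgroup — i.e. the group π₀^path(M^∨) of path components of M^∨ — is isomorphic as an abelian group to the first Ext group Ext¹_ℤ(M, ℤ) of abelian groups. -/
/-- The Pontryagin dual of a discrete abelian group `M`: all group homomorphisms
`M →+ ℝ/ℤ`, with the topology of pointwise convergence. -/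
abbrev DiscretePontryaginDual (M : Type*) [AddCommGroup M] : Type _ :=
  M →+ AddCircle (1 : ℝ)

/-- Topology of pointwise convergence on the dual. -/
noncomputable instance (M : Type*) [AddCommGroup M] :
    TopologicalSpace (DiscretePontryaginDual M) :=
  TopologicalSpace.induced (fun χ => (χ : M → AddCircle (1 : ℝ))) inferInstance

/-- The first Ext group `Ext¹_ℤ(M, ℤ)` in the category of abelian groups
(= `ℤ`-modules). -/
noncomputable abbrev Ext1Int (M : Type) [AddCommGroup M] : Type :=
  ((Ext ℤ (ModuleCat.{0} ℤ) 1).obj (Opposite.op (ModuleCat.of ℤ M))).obj (ModuleCat.of ℤ ℤ)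

theorem dual_mem_pathComponent_iff (M : Type) [AddCommGroup M] (χ : DiscretePontryaginDual M) :
    χ ∈ pathComponent (0 : DiscretePontryaginDual M) ↔
      ∃ f : M →+ ℝ, ∀ m : M, χ m = (f m : AddCircle (1 : ℝ)) := by
  have hind : Topology.IsInducing
      (fun (χ : DiscretePontryaginDual M) => (χ : M → AddCircle (1 : ℝ))) := ⟨rfl⟩
  have cov : IsCoveringMap ((↑) : ℝ → AddCircle (1 : ℝ)) := AddCircle.isCoveringMap_coe 1
  constructor
  · rintro ⟨γ⟩
    have hc : ∀ m, Continuous fun t => γ t m := fun m =>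
      (continuous_apply m).comp (hind.continuous.comp γ.continuous)
    have h0 : ∀ m, γ 0 m = ((0 : ℝ) : AddCircle (1 : ℝ)) := fun m => by simp
    have hL : ∀ m, ∃ Γ : C(unitInterval, ℝ), (∀ t, (Γ t : AddCircle (1 : ℝ)) = γ t m) ∧ Γ 0 = 0 := by
      intro m
      obtain ⟨Γ, h1, h2⟩ := cov.exists_path_lifts ⟨fun t => γ t m, hc m⟩ 0 (h0 m)
      exact ⟨Γ, fun t => congrFun h1 t, h2⟩
    choose Γ hΓ hΓ0 using hL
    have hadd : ∀ m n, Γ (m + n) = Γ m + Γ n := by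
      intro m n
      apply DFunLike.coe_injective
      refine cov.eq_of_comp_eq (Γ (m + n)).continuous (Γ m + Γ n).continuous ?_ 0 ?_
      · funext t
        simp [hΓ]
      · simp [hΓ0]
    refine ⟨AddMonoidHom.mk' (fun m => Γ m 1) fun m n => by simp [hadd], fun m => ?_⟩
    simp [hΓ]
  · rintro ⟨f, hf⟩
    let F : unitInterval → DiscretePontryaginDual M := fun t =>
      AddMonoidHom.mk' (fun m => (((t : ℝ) * f m : ℝ) : AddCircle (1 : ℝ))) fun m n => by
        simp [mul_add]
    refine ⟨⟨⟨F, ?_⟩, ?_, ?_⟩⟩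
    · rw [hind.continuous_iff]
      refine continuous_pi fun m => ?_
      exact (AddCircle.continuous_mk' (1 : ℝ)).comp (by fun_prop)
    · ext m; simp [F]
    · ext m; simp [F, hf]

/-- The image of `Hom(M, ℝ)` in the dual. -/
def liftableSubgroup (M : Type) [AddCommGroup M] : AddSubgroup (DiscretePontryaginDual M) where
  carrier := {χ | ∃ f : M →+ ℝ, ∀ m : M, χ m = (f m : AddCircle (1 : ℝ))}
  add_mem' := by
    rintro a b ⟨f, hf⟩ ⟨g, hg⟩
    exact ⟨f + g, fun m => by simp [hf, hg]⟩
  zero_mem' := ⟨0, fun m => by simp⟩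
  neg_mem' := by
    rintro a ⟨f, hf⟩
    exact ⟨-f, fun m => by simp [hf]⟩

theorem factor_of_surjective {A B C : Type*} [AddCommGroup A] [AddCommGroup B] [AddCommGroup C]
    (p : A →+ B) (hp : Function.Surjective p) (g : A →+ C) (h : ∀ x, p x = 0 → g x = 0) :
    ∃ k : B →+ C, ∀ x, k (p x) = g x :=
  ⟨p.liftOfRightInverse _ (Function.rightInverse_surjInv hp) ⟨g, fun x hx => h x hx⟩,
    fun x => p.liftOfRightInverse_comp_apply _ (Function.rightInverse_surjInv hp) ⟨g, _⟩ x⟩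

theorem int_of_real {A : Type*} [AddCommGroup A] (g : A →+ ℝ)
    (h : ∀ x, (g x : AddCircle (1 : ℝ)) = 0) : ∃ k : A →+ ℤ, ∀ x, (k x : ℝ) = g x := by
  have : ∀ x, ∃ n : ℤ, (n : ℝ) = g x := fun x => by
    obtain ⟨n, hn⟩ := (AddCircle.coe_eq_zero_iff (1 : ℝ)).1 (h x)
    exact ⟨n, by simpa using hn⟩
  choose k hk using this
  refine ⟨AddMonoidHom.mk' k fun a b => ?_, hk⟩
  have : ((k (a + b) : ℤ) : ℝ) = ((k a + k b : ℤ) : ℝ) := by simp [hk]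
  exact_mod_cast this

theorem coe_int_circle (n : ℤ) : ((n : ℝ) : AddCircle (1 : ℝ)) = 0 :=
  (AddCircle.coe_eq_zero_iff (1 : ℝ)).2 ⟨n, by simp⟩

/-- Two surjections with the same kernel have isomorphic targets. -/
theorem equiv_of_ker_eq {T A B : Type*} [AddCommGroup T] [AddCommGroup A] [AddCommGroup B]
    (α : T →+ A) (β : T →+ B) (hα : Function.Surjective α) (hβ : Function.Surjective β)
    (h : ∀ t, α t = 0 ↔ β t = 0) : Nonempty (A ≃+ B) := by
  have hk : α.ker = β.ker := by ext t; exact h t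
  exact ⟨(QuotientAddGroup.quotientKerEquivOfSurjective α hα).symm.trans
    ((QuotientAddGroup.quotientAddEquivOfEq hk).trans
      (QuotientAddGroup.quotientKerEquivOfSurjective β hβ))⟩

theorem alg_core (M P0 P1 P2 H : Type) [AddCommGroup M] [AddCommGroup P0] [AddCommGroup P1]
    [AddCommGroup P2] [AddCommGroup H] (hP : Module.Projective ℤ P0)
    (p : P0 →+ M) (d1 : P1 →+ P0) (d2 : P2 →+ P1) (hp : Function.Surjective p)
    (e0 : Function.Exact d1 p) (e1 : Function.Exact d2 d1)
    (K : AddSubgroup (P1 →+ ℤ)) (hK : ∀ c, c ∈ K ↔ ∀ x, c (d2 x) = 0)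
    (q : K →+ H) (hq : Function.Surjective q)
    (hq0 : ∀ c : K, q c = 0 ↔ ∃ h : P0 →+ ℤ, ∀ x, h (d1 x) = c.1 x) :
    Nonempty ((DiscretePontryaginDual M ⧸ liftableSubgroup M) ≃+ H) := by
  let T : AddSubgroup ((P0 →+ ℝ) × K × (DiscretePontryaginDual M)) :=
    { carrier := {t | (∀ x, t.1 (d1 x) = (t.2.1.1 x : ℝ)) ∧
        (∀ x, (t.1 x : AddCircle (1 : ℝ)) = t.2.2 (p x))}
      add_mem' := by
        rintro a b ⟨h1, h2⟩ ⟨h3, h4⟩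
        exact ⟨fun x => by simp [h1, h3], fun x => by simp [h2, h4]⟩
      zero_mem' := ⟨fun x => by simp, fun x => by simp⟩
      neg_mem' := by
        rintro a ⟨h1, h2⟩
        exact ⟨fun x => by simp [h1], fun x => by simp [h2]⟩ }
  let α : T →+ (DiscretePontryaginDual M ⧸ liftableSubgroup M) :=
    (QuotientAddGroup.mk' _).comp ((AddMonoidHom.snd _ _).comp ((AddMonoidHom.snd _ _).comp T.subtype))
  let β : T →+ H := q.comp ((AddMonoidHom.fst _ _).comp ((AddMonoidHom.snd _ _).comp T.subtype))
  refine equiv_of_ker_eq α β ?_ ?_ ?_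
  · intro y
    obtain ⟨χ, rfl⟩ := QuotientAddGroup.mk'_surjective _ y
    obtain ⟨g, hg⟩ := Module.projective_lifting_property
      (QuotientAddGroup.mk' (AddSubgroup.zmultiples (1 : ℝ))).toIntLinearMap
      (χ.comp p).toIntLinearMap (QuotientAddGroup.mk'_surjective _)
    have hg' : ∀ x, ((g x : ℝ) : AddCircle (1 : ℝ)) = χ (p x) := fun x => LinearMap.congr_fun hg x
    obtain ⟨c, hc⟩ := int_of_real (g.toAddMonoidHom.comp d1) (fun x => by
      have := hg' (d1 x)
      rw [e0.apply_apply_eq_zero] at this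
      simpa using this)
    have hcK : c ∈ K := (hK c).2 fun x => by
      have := hc (d2 x)
      simp [e1.apply_apply_eq_zero] at this
      exact_mod_cast this
    exact ⟨⟨(g.toAddMonoidHom, ⟨c, hcK⟩, χ), fun x => (hc x).symm, hg'⟩, rfl⟩
  · intro y
    obtain ⟨c, rfl⟩ := hq y
    obtain ⟨k, hk⟩ := factor_of_surjective d1.rangeRestrict d1.rangeRestrict_surjective
      ((Int.castAddHom ℝ).comp c.1) (fun x hx => by
        obtain ⟨z, rfl⟩ := (e1 x).1 (congrArg Subtype.val hx)
        simp [(hK c.1).1 c.2 z])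
    obtain ⟨g, hg⟩ := (Module.Baer.of_divisible ℝ).extension_property_addMonoidHom
      d1.range.subtype Subtype.val_injective k
    have hg' : ∀ x, g (d1 x) = (c.1 x : ℝ) := fun x => by
      have h1 := DFunLike.congr_fun hg (d1.rangeRestrict x)
      rw [hk] at h1
      exact h1
    obtain ⟨χ, hχ⟩ := factor_of_surjective p hp
      ((QuotientAddGroup.mk' (AddSubgroup.zmultiples (1 : ℝ))).comp g) (fun x hx => by
        obtain ⟨z, rfl⟩ := (e0 x).1 hx
        show ((g (d1 z) : ℝ) : AddCircle (1 : ℝ)) = 0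
        rw [hg', coe_int_circle])
    exact ⟨⟨(g, c, χ), hg', fun x => (hχ x).symm⟩, rfl⟩
  · rintro ⟨⟨g, c, χ⟩, h1, h2⟩
    change (QuotientAddGroup.mk' (liftableSubgroup M) χ = 0) ↔ q c = 0
    rw [hq0, QuotientAddGroup.mk'_apply, QuotientAddGroup.eq_zero_iff]
    dsimp only at h1 h2
    constructor
    · rintro ⟨f, hf⟩
      obtain ⟨h, hh⟩ := int_of_real (g - f.comp p) (fun x => by simp [h2, hf])
      refine ⟨h, fun x => ?_⟩
      have := hh (d1 x)
      simp [h1, e0.apply_apply_eq_zero] at this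
      exact_mod_cast this
    · rintro ⟨h, hh⟩
      obtain ⟨f, hf⟩ := factor_of_surjective p hp (g - (Int.castAddHom ℝ).comp h) (fun x hx => by
        obtain ⟨z, rfl⟩ := (e0 x).1 hx
        simp [h1, hh])
      refine ⟨f, fun m => ?_⟩
      obtain ⟨x, rfl⟩ := hp m
      rw [← h2, hf]
      simp [coe_int_circle]

/-- An additive map to `ℤ` as a `ℤ`-linear map, for any `ℤ`-module structure on the source. -/
def addToLin {A : Type} [AddCommGroup A] [Module ℤ A] (f : A →+ ℤ) : A →ₗ[ℤ] ℤ where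
  toFun := f
  map_add' := f.map_add
  map_smul' n x := by
    simpa using map_intCast_smul f ℤ ℤ n x

open CategoryTheory in
theorem ext_core (M : Type) [AddCommGroup M] :
    Nonempty ((DiscretePontryaginDual M ⧸ liftableSubgroup M) ≃+ Ext1Int M) := by
  let P := projectiveResolution (ModuleCat.of ℤ M)
  let L := P.complex.linearYonedaObj ℤ (ModuleCat.of ℤ ℤ)
  let S := L.sc' 0 1 2
  let e : Ext1Int M ≃+ S.moduleCatLeftHomologyData.H :=
    (P.isoExt 1 (ModuleCat.of ℤ ℤ) ≪≫ L.homologyIsoSc' 0 1 2 (by simp) (by simp) ≪≫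
      S.moduleCatHomologyIso).toLinearEquiv.toAddEquiv
  let d1 := (P.complex.d 1 0).hom
  let d2 := (P.complex.d 2 1).hom
  let p : P.complex.X 0 →ₗ[ℤ] M := (P.π.f 0).hom
  have e1 : Function.Exact d2 d1 :=
    (ShortComplex.ShortExact.moduleCat_exact_iff_function_exact _).1 (P.exact_succ 0)
  have e0 : Function.Exact d1 p :=
    (ShortComplex.ShortExact.moduleCat_exact_iff_function_exact
      (ShortComplex.mk _ _ P.complex_d_comp_π_f_zero)).1
      (ShortComplex.exact_of_g_is_cokernel _ P.isColimitCokernelCofork)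
  have hp : Function.Surjective p := (ModuleCat.epi_iff_surjective (P.π.f 0)).1 inferInstance
  have hP : Module.Projective ℤ (P.complex.X 0) :=
    (IsProjective.iff_projective (R := ℤ) (P.complex.X 0)).2 (P.projective 0)
  let K : AddSubgroup (P.complex.X 1 →+ ℤ) :=
    { carrier := {c | ∀ x, c (d2 x) = 0}
      add_mem' := fun {a b} ha hb x => by simp [ha x, hb x]
      zero_mem' := fun x => rfl
      neg_mem' := fun {a} ha x => by simp [ha x] }
  let j : K →+ LinearMap.ker S.g.hom := AddMonoidHom.mk'
    (fun c => ⟨(ModuleCat.ofHom (addToLin c.1) : P.complex.X 1 ⟶ ModuleCat.of ℤ ℤ), by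
      have h : P.complex.d 2 1 ≫ (ModuleCat.ofHom (addToLin c.1) : _ ⟶ ModuleCat.of ℤ ℤ) = 0 := by
        apply ModuleCat.hom_ext
        ext x
        exact c.2 x
      exact h⟩) (fun a b => rfl)
  have hj : Function.Surjective j := by
    rintro ⟨c, hc⟩
    let c' : P.complex.X 1 ⟶ ModuleCat.of ℤ ℤ := c
    refine ⟨⟨c'.hom.toAddMonoidHom, fun x => ?_⟩, ?_⟩
    · have hc' : P.complex.d 2 1 ≫ c' = 0 := hc
      exact congrArg (fun f : P.complex.X 2 ⟶ ModuleCat.of ℤ ℤ => f.hom x) hc'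
    · rfl
  let q : K →+ Ext1Int M := e.symm.toAddMonoidHom.comp
    ((Submodule.mkQ (LinearMap.range S.moduleCatToCycles)).toAddMonoidHom.comp j)
  refine alg_core M (P.complex.X 0) (P.complex.X 1) (P.complex.X 2) (Ext1Int M)
    (by convert hP; exact AddCommGroup.uniqueIntModule.uniq _ |>.symm)
    p.toAddMonoidHom d1.toAddMonoidHom d2.toAddMonoidHom hp e0 e1 K (fun c => Iff.rfl) q ?_ ?_
  · exact e.symm.surjective.comp ((Submodule.mkQ_surjective _).comp hj)
  · intro c
    have : q c = 0 ↔ Submodule.mkQ (LinearMap.range S.moduleCatToCycles) (j c) = 0 :=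
      e.symm.map_eq_zero_iff
    rw [this, Submodule.mkQ_apply, Submodule.Quotient.mk_eq_zero]
    constructor
    · rintro ⟨h, hh⟩
      let h' : P.complex.X 0 ⟶ ModuleCat.of ℤ ℤ := h
      refine ⟨h'.hom.toAddMonoidHom, fun x => ?_⟩
      have hh' : P.complex.d 1 0 ≫ h' = ModuleCat.ofHom (addToLin c.1) :=
        congrArg Subtype.val hh
      exact congrArg (fun f : P.complex.X 1 ⟶ ModuleCat.of ℤ ℤ => f.hom x) hh'
    · rintro ⟨h, hh⟩
      refine ⟨(ModuleCat.ofHom (addToLin h) : P.complex.X 0 ⟶ ModuleCat.of ℤ ℤ), ?_⟩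
      apply Subtype.ext
      have : P.complex.d 1 0 ≫ (ModuleCat.ofHom (addToLin h) : _ ⟶ ModuleCat.of ℤ ℤ) =
          ModuleCat.ofHom (addToLin c.1) := by
        apply ModuleCat.hom_ext
        ext x
        exact hh x
      exact this

/-- For a discrete abelian group `M`, the path component of the trivial character in the
Pontryagin dual `M^∨` is a subgroup, namely the image of `Hom(M, ℝ)` under composition
with the projection `ℝ → ℝ/ℤ`, and the quotient of `M^∨` by this subgroup (the group of
path components of `M^∨`) is isomorphic to `Ext¹_ℤ(M, ℤ)`. -/
theorem pathComponents_pontryaginDual_iso_ext (M : Type) [AddCommGroup M] :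
    ∃ S : AddSubgroup (DiscretePontryaginDual M),
      (S : Set (DiscretePontryaginDual M)) = pathComponent (0 : DiscretePontryaginDual M) ∧
      (S : Set (DiscretePontryaginDual M)) =
        {χ | ∃ f : M →+ ℝ, ∀ m : M, χ m = (f m : AddCircle (1 : ℝ))} ∧
      Nonempty ((DiscretePontryaginDual M ⧸ S) ≃+ Ext1Int M) := by
  refine ⟨liftableSubgroup M, ?_, rfl, ext_core M⟩
  ext χ
  exact (dual_mem_pathComponent_iff M χ).symm
end

section
/- Let F be a field of characteristic 0 containing a primitive n-th root of unity for every n ≥ 1, with algebraic closure F̄, fix an injective group homomorphism ι : μ∞ → S¹, and let E be an intermediate field F ⊆ E ⊆ F̄ that is a finite extension of F of degree d = [E : F]. Then the natural map X_E = Gal(F̄/E)\X_{F̄} → X_F = Gal(F̄/F)\X_{F̄} (induced by the identity of X_{F̄}) is a covering map, and every one of its fibers has exactly d elements; i.e. X_E → X_F is a finite covering of degree [E : F]. -/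
noncomputable section

/-- The space of characters `F̄ˣ → S¹` with the topology of pointwise convergence. -/
instance charTopology (Fbar : Type*) [Field Fbar] : TopologicalSpace (Fbarˣ →* Circle) :=
  TopologicalSpace.induced (fun χ => (χ : Fbarˣ → Circle)) inferInstance

/-- The space `X_F̄` of characters `χ : F̄ˣ → S¹` restricting to `ι` on the roots of
unity, with the topology of pointwise convergence. -/
def XChar (Fbar : Type*) [Field Fbar] (ι : (CommGroup.torsion Fbarˣ) →* Circle) : Type _ :=
  {χ : Fbarˣ →* Circle // ∀ ζ : CommGroup.torsion Fbarˣ, χ ζ = ι ζ}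

instance (Fbar : Type*) [Field Fbar] (ι : (CommGroup.torsion Fbarˣ) →* Circle) :
    TopologicalSpace (XChar Fbar ι) :=
  instTopologicalSpaceSubtype

/-- The setoid on `X_F̄` whose classes are the orbits of `Gal(F̄/K)` acting by
`σ • χ = χ ∘ σ⁻¹`. -/
def galSetoid (K : Type*) (Fbar : Type*) [Field Fbar] [CommSemiring K] [Algebra K Fbar]
    (ι : (CommGroup.torsion Fbarˣ) →* Circle) : Setoid (XChar Fbar ι) where
  r χ₁ χ₂ := ∃ σ : Fbar ≃ₐ[K] Fbar, ∀ x : Fbarˣ,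
    χ₂.1 x = χ₁.1 (Units.map (σ : Fbar →* Fbar) x)
  iseqv := by
    constructor
    · intro χ
      refine ⟨1, fun x => ?_⟩
      have h1 : Units.map ((1 : Fbar ≃ₐ[K] Fbar) : Fbar →* Fbar) x = x := by
        ext; simp
      rw [h1]
    · rintro χ₁ χ₂ ⟨σ, h⟩
      refine ⟨σ.symm, fun x => ?_⟩
      have h1 : Units.map (σ : Fbar →* Fbar) (Units.map (σ.symm : Fbar →* Fbar) x) = x := by
        ext; simp
      rw [h (Units.map (σ.symm : Fbar →* Fbar) x), h1]
    · rintro χ₁ χ₂ χ₃ ⟨σ, h⟩ ⟨τ, h'⟩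
      refine ⟨τ.trans σ, fun x => ?_⟩
      have h1 : Units.map ((τ.trans σ : Fbar ≃ₐ[K] Fbar) : Fbar →* Fbar) x
          = Units.map (σ : Fbar →* Fbar) (Units.map (τ : Fbar →* Fbar) x) := by
        ext; simp
      rw [h' x, h (Units.map (τ : Fbar →* Fbar) x), h1]

/-- The quotient `X_K = Gal(F̄/K)\X_F̄`, with the quotient topology. -/
def XF (K : Type*) (Fbar : Type*) [Field Fbar] [CommSemiring K] [Algebra K Fbar]
    (ι : (CommGroup.torsion Fbarˣ) →* Circle) : Type _ :=
  Quotient (galSetoid K Fbar ι)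

instance (K : Type*) (Fbar : Type*) [Field Fbar] [CommSemiring K] [Algebra K Fbar]
    (ι : (CommGroup.torsion Fbarˣ) →* Circle) : TopologicalSpace (XF K Fbar ι) :=
  instTopologicalSpaceQuotient

/-- The natural projection `X_E → X_F` for an intermediate field `F ⊆ E ⊆ F̄`, induced by
the identity of `X_F̄`. -/
def XFproj (F : Type*) (Fbar : Type*) [Field F] [Field Fbar] [Algebra F Fbar]
    (ι : (CommGroup.torsion Fbarˣ) →* Circle) (E : IntermediateField F Fbar) :
    XF E Fbar ι → XF F Fbar ι :=
  Quotient.map' id (by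
    rintro χ₁ χ₂ ⟨σ, h⟩
    refine ⟨σ.restrictScalars F, fun x => ?_⟩
    have h1 : Units.map ((σ.restrictScalars F : Fbar ≃ₐ[F] Fbar) : Fbar →* Fbar) x
        = Units.map (σ : Fbar →* Fbar) x := by
      ext; simp
    rw [h1]
    exact h x)

noncomputable section

lemma aux_resolvent {F N : Type*} [Field F] [CharZero F] [Field N] [Algebra F N]
    [FiniteDimensional F N]
    (hroots : ∀ n : ℕ, 0 < n → ∃ ζ : F, IsPrimitiveRoot ζ n) (τ : N ≃ₐ[F] N) (hτ : τ ≠ 1) :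
    ∃ (b : N) (ξ : F) (n : ℕ), b ≠ 0 ∧ 0 < n ∧ ξ ^ n = 1 ∧ ξ ≠ 1 ∧ τ b = algebraMap F N ξ * b := by
  obtain ⟨x, hx⟩ : ∃ x, τ x ≠ x := by
    by_contra! h
    exact hτ (AlgEquiv.ext h)
  have hn : 0 < orderOf τ := orderOf_pos τ
  have hpow := pow_orderOf_eq_one τ
  generalize orderOf τ = n at hn hpow
  obtain ⟨ζ, hζ⟩ := hroots n hn
  have : CharZero N := charZero_of_injective_algebraMap (algebraMap F N).injective
  let y : ℕ → N := fun k => ∑ i ∈ Finset.range n, algebraMap F N ((ζ ^ k) ^ i) * (τ ^ i) x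
  have hτy : ∀ k, algebraMap F N (ζ ^ k) * τ (y k) = y k := by
    intro k
    have h1 : algebraMap F N (ζ ^ k) * τ (y k) = ∑ i ∈ Finset.range n,
        algebraMap F N ((ζ ^ k) ^ (i+1)) * (τ ^ (i+1)) x := by
      simp only [y, map_sum, Finset.mul_sum, map_mul, AlgEquiv.commutes]
      refine Finset.sum_congr rfl fun i _ => ?_
      rw [pow_succ' τ, pow_succ' (ζ ^ k), map_mul, AlgEquiv.mul_apply, mul_assoc]
    rw [h1]
    have h2 := Finset.sum_range_succ (fun i => algebraMap F N ((ζ ^ k) ^ i) * (τ ^ i) x) n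
    rw [Finset.sum_range_succ'] at h2
    have h3 : (ζ ^ k) ^ n = 1 := by rw [← pow_mul, mul_comm, pow_mul, hζ.pow_eq_one, one_pow]
    rw [h3, hpow] at h2
    simpa [y] using h2
  have hsum : ∑ k ∈ Finset.range n, y k = n * x := by
    simp only [y]
    rw [Finset.sum_comm]
    rw [Finset.sum_eq_single_of_mem 0 (Finset.mem_range.2 hn)]
    · simp
    · intro i hi hi0
      rw [← Finset.sum_mul, ← map_sum]
      have h4 : ∑ k ∈ Finset.range n, (ζ ^ k) ^ i = 0 := by
        have h5 : ζ ^ i ≠ 1 := hζ.pow_ne_one_of_pos_of_lt hi0 (Finset.mem_range.1 hi)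
        have h6 := geom_sum_mul (ζ ^ i) n
        rw [← pow_mul, mul_comm i n, pow_mul, hζ.pow_eq_one, one_pow, sub_self] at h6
        rcases mul_eq_zero.1 h6 with h | h
        · rw [← h]
          refine Finset.sum_congr rfl fun k _ => ?_
          rw [← pow_mul, ← pow_mul, mul_comm]
        · exact absurd (sub_eq_zero.1 h) h5
      rw [h4]; simp
  obtain ⟨k, hkn, hk0, hyk⟩ : ∃ k, k < n ∧ k ≠ 0 ∧ y k ≠ 0 := by
    by_contra! h
    rw [Finset.sum_eq_single_of_mem 0 (Finset.mem_range.2 hn)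
      (fun k hk hk0 => h k (Finset.mem_range.1 hk) hk0)] at hsum
    have h7 := hτy 0
    rw [hsum] at h7
    simp only [pow_zero, map_one, one_mul, map_mul, map_natCast] at h7
    exact hx (mul_left_cancel₀ (by exact_mod_cast hn.ne') h7)
  have hζk : ζ ^ k ≠ 0 := pow_ne_zero _ (hζ.ne_zero hn.ne')
  refine ⟨y k, (ζ ^ k)⁻¹, n, hyk, hn, ?_, ?_, ?_⟩
  · rw [inv_pow, ← pow_mul, mul_comm, pow_mul, hζ.pow_eq_one, one_pow, inv_one]
  · rw [Ne, inv_eq_one]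
    exact hζ.pow_ne_one_of_pos_of_lt hk0 hkn
  · have h8 : algebraMap F N (ζ ^ k) ≠ 0 := by simpa using hζk
    rw [map_inv₀, eq_inv_mul_iff_mul_eq₀ h8]
    exact hτy k

section
variable {F Fbar : Type*} [Field F] [Field Fbar] [Algebra F Fbar]
    {ι : (CommGroup.torsion Fbarˣ) →* Circle}

lemma aux_torsion (hroots : ∀ n : ℕ, 0 < n → ∃ ζ : F, IsPrimitiveRoot ζ n)
    (σ : Fbar ≃ₐ[F] Fbar) (z : CommGroup.torsion Fbarˣ) :
    Units.map (σ : Fbar →* Fbar) z = z := by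
  obtain ⟨n, hn, hz⟩ := (isOfFinOrder_iff_pow_eq_one (x := (z : Fbarˣ))).1 z.2
  obtain ⟨ζ, hζ⟩ := hroots n hn
  have h1 : IsPrimitiveRoot (algebraMap F Fbar ζ) n :=
    hζ.map_of_injective (algebraMap F Fbar).injective
  have h2 : ((z : Fbarˣ) : Fbar) ^ n = 1 := by
    rw [← Units.val_pow_eq_pow_val, hz, Units.val_one]
  have : NeZero n := ⟨hn.ne'⟩
  obtain ⟨i, -, hi⟩ := h1.eq_pow_of_pow_eq_one h2
  ext
  simp [← hi]

lemma aux_eval_continuous (x : Fbarˣ) : Continuous (fun χ : XChar Fbar ι => χ.1 x) :=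
  (continuous_apply x).comp (continuous_induced_dom.comp continuous_subtype_val)

/-- Precomposition of a character by a Galois automorphism. -/
def auxPre (hroots : ∀ n : ℕ, 0 < n → ∃ ζ : F, IsPrimitiveRoot ζ n)
    (σ : Fbar ≃ₐ[F] Fbar) (χ : XChar Fbar ι) : XChar Fbar ι :=
  ⟨χ.1.comp (Units.map (σ : Fbar →* Fbar)), fun z => by
    rw [MonoidHom.comp_apply, aux_torsion hroots, χ.2]⟩

lemma auxPre_apply (hroots : ∀ n : ℕ, 0 < n → ∃ ζ : F, IsPrimitiveRoot ζ n)
    (σ : Fbar ≃ₐ[F] Fbar) (χ : XChar Fbar ι) (x : Fbarˣ) :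
    (auxPre hroots σ χ).1 x = χ.1 (Units.map (σ : Fbar →* Fbar) x) := rfl

lemma auxPre_continuous (hroots : ∀ n : ℕ, 0 < n → ∃ ζ : F, IsPrimitiveRoot ζ n)
    (σ : Fbar ≃ₐ[F] Fbar) : Continuous (auxPre (ι := ι) hroots σ) := by
  refine Continuous.subtype_mk (continuous_induced_rng.2 (continuous_pi fun x => ?_)) _
  exact aux_eval_continuous (ι := ι) _

lemma aux_ext {χ χ' : XChar Fbar ι} (h : ∀ x, χ.1 x = χ'.1 x) : χ = χ' :=
  Subtype.ext (MonoidHom.ext h)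

lemma auxPre_trans (hroots : ∀ n : ℕ, 0 < n → ∃ ζ : F, IsPrimitiveRoot ζ n)
    (σ τ : Fbar ≃ₐ[F] Fbar) (χ : XChar Fbar ι) :
    auxPre hroots σ (auxPre hroots τ χ) = auxPre hroots (σ.trans τ) χ := rfl

lemma auxPre_refl (hroots : ∀ n : ℕ, 0 < n → ∃ ζ : F, IsPrimitiveRoot ζ n)
    (χ : XChar Fbar ι) :
    auxPre hroots (AlgEquiv.refl : Fbar ≃ₐ[F] Fbar) χ = χ := rfl

lemma aux_mkF_eq (hroots : ∀ n : ℕ, 0 < n → ∃ ζ : F, IsPrimitiveRoot ζ n)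
    (χ χ' : XChar Fbar ι) :
    (Quotient.mk _ χ : XF F Fbar ι) = Quotient.mk _ χ' ↔
      ∃ σ : Fbar ≃ₐ[F] Fbar, χ' = auxPre hroots σ χ := by
  refine Quotient.eq.trans ⟨?_, ?_⟩
  · rintro ⟨σ, h⟩
    exact ⟨σ, aux_ext h⟩
  · rintro ⟨σ, h⟩
    exact ⟨σ, fun x => by rw [h]; rfl⟩

lemma aux_mkF_open (hroots : ∀ n : ℕ, 0 < n → ∃ ζ : F, IsPrimitiveRoot ζ n) :
    IsOpenMap (fun χ : XChar Fbar ι => (Quotient.mk _ χ : XF F Fbar ι)) := by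
  intro U hU
  refine isOpen_coinduced.2 ?_
  have : (Quotient.mk _ ⁻¹' ((fun χ : XChar Fbar ι => (Quotient.mk _ χ : XF F Fbar ι)) '' U)) =
      ⋃ σ : Fbar ≃ₐ[F] Fbar, auxPre hroots σ ⁻¹' U := by
    ext χ
    simp only [Set.mem_preimage, Set.mem_image, Set.mem_iUnion]
    constructor
    · rintro ⟨χ', h', h⟩
      obtain ⟨σ, hσ⟩ := (aux_mkF_eq hroots χ χ').1 h.symm
      exact ⟨σ, hσ ▸ h'⟩
    · rintro ⟨σ, hσ⟩
      exact ⟨_, hσ, ((aux_mkF_eq hroots _ _).2 ⟨σ, rfl⟩).symm⟩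
  refine this.symm ▸ ?_
  exact isOpen_iUnion fun σ => hU.preimage (auxPre_continuous hroots σ)

lemma aux_hrootsE (hroots : ∀ n : ℕ, 0 < n → ∃ ζ : F, IsPrimitiveRoot ζ n)
    (E : IntermediateField F Fbar) : ∀ n : ℕ, 0 < n → ∃ ζ : E, IsPrimitiveRoot ζ n := by
  intro n hn
  obtain ⟨ζ, h⟩ := hroots n hn
  exact ⟨algebraMap F E ζ, h.map_of_injective (algebraMap F E).injective⟩

lemma aux_mkE_eq (hroots : ∀ n : ℕ, 0 < n → ∃ ζ : F, IsPrimitiveRoot ζ n)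
    (E : IntermediateField F Fbar) (χ χ' : XChar Fbar ι) :
    (Quotient.mk _ χ : XF E Fbar ι) = Quotient.mk _ χ' ↔
      ∃ σ : Fbar ≃ₐ[F] Fbar, (∀ x ∈ E, σ x = x) ∧ χ' = auxPre hroots σ χ := by
  rw [aux_mkF_eq (aux_hrootsE hroots E)]
  constructor
  · rintro ⟨σ, h⟩
    exact ⟨σ.restrictScalars F, fun x hx => σ.commutes ⟨x, hx⟩, h⟩
  · rintro ⟨σ, hσ, h⟩
    exact ⟨{ σ with commutes' := fun x => hσ x.1 x.2 }, h⟩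

/-- Small neighbourhoods: two equivalent points are related by an element fixing `N`. -/
lemma aux_nhd [CharZero F]
    (hroots : ∀ n : ℕ, 0 < n → ∃ ζ : F, IsPrimitiveRoot ζ n) (hι : Function.Injective ι)
    (N : IntermediateField F Fbar) [FiniteDimensional F N] [Normal F N] (χ : XChar Fbar ι) :
    ∃ U : Set (XChar Fbar ι), IsOpen U ∧ χ ∈ U ∧ ∀ χ₁ ∈ U, ∀ χ₂ ∈ U, ∀ σ : Fbar ≃ₐ[F] Fbar,
      χ₂ = auxPre hroots σ χ₁ → ∀ x ∈ N, σ x = x := by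
  have key : ∀ τ : N ≃ₐ[F] N, ∃ U : Set (XChar Fbar ι), IsOpen U ∧ χ ∈ U ∧
      ∀ χ₁ ∈ U, ∀ χ₂ ∈ U, ∀ σ : Fbar ≃ₐ[F] Fbar,
      χ₂ = auxPre hroots σ χ₁ → (∀ x : N, σ x = τ x) → τ = 1 := by
    intro τ
    by_cases hτ : τ = 1
    · exact ⟨Set.univ, isOpen_univ, trivial, fun _ _ _ _ _ _ _ => hτ⟩
    obtain ⟨b, ξ, n, hb, hn, hξn, hξ, hτb⟩ := aux_resolvent hroots τ hτ
    have hb' : (b : Fbar) ≠ 0 := by simpa using hb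
    have hξ0 : algebraMap F Fbar ξ ≠ 0 := by
      rintro h
      rw [map_eq_zero] at h
      rw [h, zero_pow hn.ne'] at hξn
      exact zero_ne_one hξn
    let B : Fbarˣ := Units.mk0 _ hb'
    let Z : Fbarˣ := Units.mk0 _ hξ0
    have hZ : Z ∈ CommGroup.torsion Fbarˣ := by
      refine isOfFinOrder_iff_pow_eq_one.2 ⟨n, hn, ?_⟩
      ext
      simp only [Z, Units.val_pow_eq_pow_val, Units.val_mk0, Units.val_one]
      rw [← map_pow, hξn, map_one]
    have hιZ : ι ⟨Z, hZ⟩ ≠ 1 := by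
      intro h
      have h2 := hι (h.trans (map_one ι).symm)
      have h3 : Z = 1 := congrArg Subtype.val h2
      have h4 : algebraMap F Fbar ξ = 1 := congrArg Units.val h3
      exact hξ ((algebraMap F Fbar).injective (by rw [h4, map_one]))
    have hcont : Continuous (fun χ' : XChar Fbar ι => χ'.1 B) := aux_eval_continuous B
    have hne : ι ⟨Z, hZ⟩ * χ.1 B ≠ χ.1 B := by
      intro h
      exact hιZ (mul_eq_right.1 h)
    obtain ⟨V, W, hV, hW, hVm, hWm, hVW⟩ := t2_separation hne
    refine ⟨(fun χ' => ι ⟨Z, hZ⟩ * χ'.1 B) ⁻¹' V ∩ (fun χ' => χ'.1 B) ⁻¹' W, ?_, ⟨hVm, hWm⟩, ?_⟩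
    · exact (hV.preimage (continuous_const.mul hcont)).inter (hW.preimage hcont)
    · rintro χ₁ ⟨h1, -⟩ χ₂ ⟨-, h2⟩ σ rfl hσ
      exfalso
      refine Set.disjoint_left.1 hVW h1 ?_
      have h5 : Units.map (σ : Fbar →* Fbar) B = Z * B := by
        ext
        have := hσ b
        rw [hτb] at this
        exact this
      have h6 : (auxPre hroots σ χ₁).1 B = ι ⟨Z, hZ⟩ * χ₁.1 B := by
        rw [auxPre_apply, h5, map_mul, ← χ₁.2]
      simp only [Set.mem_preimage, h6] at h2
      exact h2
  choose U hU hχU hUσ using key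
  refine ⟨⋂ τ, U τ, isOpen_iInter_of_finite hU, Set.mem_iInter.2 hχU, ?_⟩
  intro χ₁ h1 χ₂ h2 σ h x hx
  have hr : ∀ x : N, σ x = σ.restrictNormal N x := fun x =>
    (AlgEquiv.restrictNormal_commutes σ N x).symm
  have := hUσ (σ.restrictNormal N) χ₁ (Set.mem_iInter.1 h1 _) χ₂ (Set.mem_iInter.1 h2 _) σ h hr
  have h3 := hr ⟨x, hx⟩
  rw [this] at h3
  exact h3

lemma aux_proj_mk (E : IntermediateField F Fbar) (χ : XChar Fbar ι) :
    XFproj F Fbar ι E (Quotient.mk _ χ) = Quotient.mk _ χ := rfl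

lemma aux_proj_continuous (E : IntermediateField F Fbar) : Continuous (XFproj F Fbar ι E) :=
  continuous_coinduced_dom.2 continuous_coinduced_rng

lemma aux_proj_open (hroots : ∀ n : ℕ, 0 < n → ∃ ζ : F, IsPrimitiveRoot ζ n)
    (E : IntermediateField F Fbar) : IsOpenMap (XFproj F Fbar ι E) := by
  intro W hW
  have h1 : IsOpen ((fun χ : XChar Fbar ι => (Quotient.mk _ χ : XF E Fbar ι)) ⁻¹' W) :=
    isOpen_coinduced.1 hW
  convert! aux_mkF_open (ι := ι) hroots _ h1 using 1
  ext c
  constructor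
  · rintro ⟨e, he, rfl⟩
    induction e using Quotient.inductionOn with
    | h χ => exact ⟨χ, he, rfl⟩
  · rintro ⟨χ, he, rfl⟩
    exact ⟨_, he, rfl⟩

lemma aux_even [CharZero F] [IsAlgClosure F Fbar]
    (hroots : ∀ n : ℕ, 0 < n → ∃ ζ : F, IsPrimitiveRoot ζ n) (hι : Function.Injective ι)
    (E : IntermediateField F Fbar) [FiniteDimensional F E] (c : XF F Fbar ι)
    [TopologicalSpace (E →ₐ[F] Fbar)] [DiscreteTopology (E →ₐ[F] Fbar)] :
    IsEvenlyCovered (XFproj F Fbar ι E) c (E →ₐ[F] Fbar) := by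
  have halg : Algebra.IsAlgebraic F Fbar := IsAlgClosure.isAlgebraic
  have hac : IsAlgClosed Fbar := IsAlgClosure.isAlgClosed F
  have hnormal : Normal F Fbar := IsAlgClosure.normal F Fbar
  induction c using Quotient.inductionOn with
  | h χ =>
  have hlift : ∀ φ : E →ₐ[F] Fbar, ∃ σ : Fbar ≃ₐ[F] Fbar, ∀ x : E, σ x = φ x := by
    intro φ
    obtain ⟨ψ, hψ⟩ := IsAlgClosed.surjective_domRestrict_of_isAlgebraic (K := F) (L := E)
      (E := Fbar) φ
    refine ⟨AlgEquiv.ofBijective ψ (Algebra.IsAlgebraic.algHom_bijective ψ), fun x => ?_⟩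
    rw [← hψ]; rfl
  choose s hs using hlift
  let N : IntermediateField F Fbar := IntermediateField.normalClosure F E Fbar
  have hEN : E ≤ N := E.le_normalClosure
  obtain ⟨U, hU, hχU, hUσ⟩ := aux_nhd hroots hι N χ
  have hne1 : Nonempty (XF F Fbar ι → XF E Fbar ι) := ⟨fun _ => Quotient.mk _ χ⟩
  have hne2 : Nonempty (E →ₐ[F] Fbar) := ⟨E.val⟩
  let mkE : XChar Fbar ι → XF E Fbar ι := fun χ => Quotient.mk _ χ
  let mkF : XChar Fbar ι → XF F Fbar ι := fun χ => Quotient.mk _ χ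
  let V : Set (XF F Fbar ι) := mkF '' U
  let S : (E →ₐ[F] Fbar) → Set (XF E Fbar ι) := fun φ =>
    mkE '' (auxPre hroots (s φ).symm ⁻¹' U)
  have hS : ∀ φ, IsOpen (S φ) := fun φ =>
    aux_mkF_open (aux_hrootsE hroots E) _ (hU.preimage (auxPre_continuous hroots _))
  have hV : IsOpen V := aux_mkF_open hroots _ hU
  -- the key computation
  have hkey : ∀ φ φ' : E →ₐ[F] Fbar, ∀ χ₁ χ₂ : XChar Fbar ι, ∀ σ : Fbar ≃ₐ[F] Fbar,
      auxPre hroots (s φ).symm χ₁ ∈ U → auxPre hroots (s φ').symm χ₂ ∈ U →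
      χ₂ = auxPre hroots σ χ₁ → ∀ x ∈ N, s φ (σ ((s φ').symm x)) = x := by
    rintro φ φ' χ₁ χ₂ σ h1 h2 rfl
    exact hUσ _ h1 _ h2 (((s φ').symm.trans σ).trans (s φ)) (by
      refine aux_ext fun x => ?_
      simp only [auxPre_apply]
      congr 1
      ext; simp)
  have hsN : ∀ σ : Fbar ≃ₐ[F] Fbar, ∀ x ∈ N, σ x ∈ N := by
    intro σ x hx
    have := AlgEquiv.restrictNormal_commutes σ N ⟨x, hx⟩
    have h2 : σ x = σ.restrictNormal N ⟨x, hx⟩ := this.symm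
    rw [h2]
    exact Subtype.prop _
  have hinj : ∀ φ, (S φ).InjOn (XFproj F Fbar ι E) := by
    rintro φ _ ⟨χ₁, h1, rfl⟩ _ ⟨χ₂, h2, rfl⟩ h
    obtain ⟨σ, hσ⟩ := (aux_mkF_eq hroots χ₁ χ₂).1 h
    refine (aux_mkE_eq hroots E χ₁ χ₂).2 ⟨σ, fun x hx => ?_, hσ⟩
    have := hkey φ φ χ₁ χ₂ σ h1 h2 hσ (s φ x) (hsN _ _ (hEN hx))
    simpa using this
  have hsurj : ∀ φ, (S φ).SurjOn (XFproj F Fbar ι E) V := by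
    rintro φ _ ⟨χ₁, h1, rfl⟩
    refine ⟨mkE (auxPre hroots (s φ) χ₁), ⟨_, ?_, rfl⟩, ?_⟩
    · rw [Set.mem_preimage, auxPre_trans, AlgEquiv.symm_trans_self, auxPre_refl]
      exact h1
    · exact ((aux_mkF_eq hroots _ _).2 ⟨s φ, rfl⟩).symm
  have hdisj : Pairwise (Function.onFun Disjoint S) := by
    intro φ φ' hφ
    refine Set.disjoint_left.2 ?_
    rintro _ ⟨χ₁, h1, rfl⟩ ⟨χ₂, h2, h⟩
    obtain ⟨σ, hσE, hσ⟩ := (aux_mkE_eq hroots E χ₁ χ₂).1 h.symm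
    apply hφ
    ext x
    have := hkey φ φ' χ₁ χ₂ σ h1 h2 hσ (s φ' x) (hsN _ _ (hEN x.2))
    rw [AlgEquiv.symm_apply_apply, hσE _ x.2, hs, hs] at this
    exact this
  have hexh : XFproj F Fbar ι E ⁻¹' V ⊆ ⋃ φ, S φ := by
    intro e
    induction e using Quotient.inductionOn with
    | h χ₁ =>
    rintro ⟨χ₂, h2, h⟩
    obtain ⟨σ, rfl⟩ := (aux_mkF_eq hroots χ₂ χ₁).1 h
    let φ : E →ₐ[F] Fbar := (σ : Fbar →ₐ[F] Fbar).comp E.val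
    refine Set.mem_iUnion.2 ⟨φ, auxPre hroots (s φ) χ₂, ?_, ?_⟩
    · rw [Set.mem_preimage, auxPre_trans, AlgEquiv.symm_trans_self, auxPre_refl]
      exact h2
    · refine (aux_mkE_eq hroots E _ _).2 ⟨σ.trans (s φ).symm, fun x hx => ?_, ?_⟩
      · have : s φ x = σ x := hs φ ⟨x, hx⟩
        rw [AlgEquiv.trans_apply, ← this, AlgEquiv.symm_apply_apply]
      · refine aux_ext fun x => ?_
        simp only [auxPre_apply]
        congr 1
        ext; simp
  refine IsEvenlyCovered.of_trivialization (t := IsOpen.trivializationDiscrete S V hV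
    ?_ hinj hsurj hdisj hexh) ⟨χ, hχU, rfl⟩
  intro φ W hW
  refine ⟨fun h => (h.preimage (aux_proj_continuous E)).inter (hS φ), fun h => ?_⟩
  have h2 : W = XFproj F Fbar ι E '' (XFproj F Fbar ι E ⁻¹' W ∩ S φ) := by
    ext w
    constructor
    · intro hw
      obtain ⟨e, he, rfl⟩ := hsurj φ (hW hw)
      exact ⟨e, ⟨hw, he⟩, rfl⟩
    · rintro ⟨e, ⟨he, -⟩, rfl⟩
      exact he
  rw [h2]
  exact aux_proj_open hroots E _ h

end
end

/-- Let `F` be a field of characteristic `0` containing all roots of unity, `F̄` an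
algebraic closure, `ι : μ∞ → S¹` injective, and `E` a finite extension of `F` inside
`F̄`.  Then the natural map `X_E → X_F` is a finite covering of degree `[E : F]`. -/
theorem XFproj_isCoveringMap_degree (F Fbar : Type*) [Field F] [CharZero F] [Field Fbar]
    [Algebra F Fbar] [IsAlgClosure F Fbar]
    (hroots : ∀ n : ℕ, 0 < n → ∃ ζ : F, IsPrimitiveRoot ζ n)
    (ι : (CommGroup.torsion Fbarˣ) →* Circle) (hι : Function.Injective ι)
    (E : IntermediateField F Fbar) [FiniteDimensional F E] :
    IsCoveringMap (XFproj F Fbar ι E) ∧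
      ∀ c : XF F Fbar ι, Nat.card ((XFproj F Fbar ι E) ⁻¹' {c}) = Module.finrank F E := by
  have hac : IsAlgClosed Fbar := IsAlgClosure.isAlgClosed F
  let : TopologicalSpace (E →ₐ[F] Fbar) := ⊥
  have : DiscreteTopology (E →ₐ[F] Fbar) := ⟨rfl⟩
  refine ⟨fun c => (aux_even hroots hι E c).to_isEvenlyCovered_preimage, fun c => ?_⟩
  rw [← Nat.card_congr (aux_even hroots hι E c).fiberHomeomorph.toEquiv]
  exact AlgHom.natCard_of_splits F E Fbar fun _ => IsAlgClosed.splits _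


end
end

section
/- Let F be a field of characteristic 0 containing a primitive n-th root of unity for every n ≥ 1, with algebraic closure F̄, and fix an injective group homomorphism ι : μ∞ → S¹. Assume there exists an element α ∈ Fˣ which is not a root of unity such that for infinitely many n ∈ ℕ there exists β ∈ F with βⁿ = α. Then the space X_F has uncountably many path components, i.e. the set of equivalence classes of points of X_F under the relation 'joined by a continuous path' is uncountable. -/
noncomputable section

open Filter Topology in
theorem aux_limit_char {G : Type*} [CommGroup G] (l : Additive G →+ ℚ) (c : ℕ → ℕ) :
    ∃ ψ : G →* Circle, ∀ (x : G) (z : Circle) (j : ℕ),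
      (∀ k, j ≤ k → Circle.exp (2 * Real.pi * (c k * (l (Additive.ofMul x) : ℝ))) = z) →
        ψ x = z := by
  let f : ℕ → G → Circle := fun k x =>
    Circle.exp (2 * Real.pi * (c k * (l (Additive.ofMul x) : ℝ)))
  have h : ∀ x, ∃ z, Tendsto (fun k => f k x) (hyperfilter ℕ : Filter ℕ) (𝓝 z) := by
    intro x
    have := (Ultrafilter.map (fun k => f k x) (hyperfilter ℕ)).le_nhds_lim
    exact ⟨_, this⟩
  choose g hg using h
  refine ⟨MonoidHom.mk' g ?_, ?_⟩
  · intro a b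
    refine tendsto_nhds_unique (hg (a * b)) ?_
    refine ((hg a).mul (hg b)).congr ?_
    intro k
    simp only [f]
    rw [← Circle.exp_add, ofMul_mul, l.map_add]
    congr 1
    push_cast
    ring
  · intro x z j hz
    refine tendsto_nhds_unique (hg x) ?_
    refine tendsto_const_nhds.congr' ?_
    have : ∀ᶠ k in (atTop : Filter ℕ), z = f k x := by
      filter_upwards [eventually_ge_atTop j] with k hk
      exact (hz k hk).symm
    exact Filter.Eventually.filter_mono (Nat.hyperfilter_le_atTop) this

theorem aux_extend {A : Type*} [CommGroup A] (B : Subgroup A) (f : B →* Circle) :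
    ∃ g : A →* Circle, ∀ b : B, g b = f b := by
  have hroot : ∀ {n : ℤ}, n ≠ 0 → Function.Surjective (fun a : Circle => a ^ n) := by
    intro n hn z
    obtain ⟨t, rfl⟩ := Circle.exp_surjective z
    refine ⟨Circle.exp (t / n), ?_⟩
    have hn' : (n : ℝ) ≠ 0 := by exact_mod_cast hn
    show Circle.exp (t / n) ^ n = _
    rw [← Circle.exp_intCast_mul]
    congr 1
    field_simp
  let _ : RootableBy Circle ℤ := rootableByOfPowLeftSurj _ _ hroot
  let _ : DivisibleBy (Additive Circle) ℤ :=
    { div := fun a n => Additive.ofMul (RootableBy.root a.toMul n)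
      div_zero := fun a => congrArg Additive.ofMul (RootableBy.root_zero a.toMul)
      div_cancel := fun {n} a hn => congrArg Additive.ofMul
        (RootableBy.root_cancel a.toMul hn) }
  obtain ⟨h, hh⟩ := (Module.Baer.of_divisible (Additive Circle)).extension_property_addMonoidHom
    (MonoidHom.toAdditive B.subtype) (fun a b hab => Subtype.ext hab) (MonoidHom.toAdditive f)
  exact ⟨MonoidHom.toAdditive.symm h, fun b => DFunLike.congr_fun hh (Additive.ofMul b)⟩

theorem aux_functional {A : Type*} [CommGroup A] (a : A) (ha : ¬ IsOfFinOrder a) :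
    ∃ l : Additive A →+ ℚ, l (Additive.ofMul a) = 1 := by
  have hinj : Function.Injective (zmultiplesHom (Additive A) (Additive.ofMul a)) := by
    intro m n hmn
    exact (injective_zpow_iff_not_isOfFinOrder.2 ha) hmn
  obtain ⟨h, hh⟩ := (Module.Baer.of_divisible ℚ).extension_property_addMonoidHom
    (zmultiplesHom (Additive A) (Additive.ofMul a)) hinj (Int.castAddHom ℚ)
  refine ⟨h, ?_⟩
  have := DFunLike.congr_fun hh 1
  simpa using this

open unitInterval in
theorem aux_lift (f : C(I, Circle)) : ∃ g : C(I, ℝ), ∀ t, Circle.exp (g t) = f t := by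
  obtain ⟨e, he⟩ := Circle.exp_surjective (f 0)
  obtain ⟨g, hg, -⟩ := Circle.isCoveringMap_exp.exists_path_lifts f e he.symm
  exact ⟨g, fun t => congrFun hg t⟩

open unitInterval in
theorem aux_displacement (f : C(I, Circle)) : ∃ R : ℝ, ∀ (n : ℕ) (h : C(I, Circle)), 0 < n →
    (∀ t, h t ^ n = f t) → h 1 = h 0 * Circle.exp (R / n) := by
  obtain ⟨g, hg⟩ := aux_lift f
  refine ⟨g 1 - g 0, fun n h hn hh => ?_⟩
  obtain ⟨k, hk⟩ := aux_lift h
  have key : ∀ t, Circle.exp (n * k t - g t) = 1 := by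
    intro t
    rw [Circle.exp_sub, Circle.exp_natCast_mul, hk, hg, hh, div_self']
  have hc := Circle.isCoveringMap_exp.const_of_comp (A := I) (g := fun t => n * k t - g t)
    (by fun_prop) (fun a a' => by rw [key, key]) 1 0
  have hn' : (n : ℝ) ≠ 0 := by positivity
  rw [← hk, ← hk, ← Circle.exp_add]
  congr 1
  field_simp
  linarith

theorem aux_lcm {F : Type*} [Field F] (α : Fˣ) (m n : ℕ) (hm : 0 < m)
    (β γ : Fˣ) (hβ : β ^ m = α) (hγ : γ ^ n = α) : ∃ δ : Fˣ, δ ^ (Nat.lcm m n) = α := by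
  obtain ⟨a, ha⟩ := Nat.gcd_dvd_left m n
  obtain ⟨b, hb⟩ := Nat.gcd_dvd_right m n
  have hd : 0 < Nat.gcd m n := Nat.gcd_pos_of_pos_left n hm
  have hl : Nat.lcm m n = m * b := by
    apply Nat.eq_of_mul_eq_mul_left hd
    rw [Nat.gcd_mul_lcm]
    conv_lhs => rw [hb]
    ring
  have hl2 : m * b = n * a := by
    conv_lhs => rw [ha]
    conv_rhs => rw [hb]
    ring
  have hbez := Nat.gcd_eq_gcd_ab m n
  have hone : (a : ℤ) * Nat.gcdA m n + b * Nat.gcdB m n = 1 := by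
    have hd' : (Nat.gcd m n : ℤ) ≠ 0 := by exact_mod_cast hd.ne'
    apply mul_left_cancel₀ hd'
    have ha' : (m : ℤ) = Nat.gcd m n * a := by exact_mod_cast ha
    have hb' : (n : ℤ) = Nat.gcd m n * b := by exact_mod_cast hb
    calc _ = (Nat.gcd m n * a : ℤ) * Nat.gcdA m n + (Nat.gcd m n * b) * Nat.gcdB m n := by ring
      _ = _ := by rw [← ha', ← hb', ← hbez, mul_one]
  refine ⟨γ ^ (Nat.gcdA m n) * β ^ (Nat.gcdB m n), ?_⟩
  have h1 : (γ ^ (Nat.gcdA m n)) ^ (m * b) = α ^ ((a : ℤ) * Nat.gcdA m n) := by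
    rw [hl2, ← hγ, ← zpow_natCast, ← zpow_natCast, ← zpow_mul, ← zpow_mul]
    congr 1; push_cast; ring
  have h2 : (β ^ (Nat.gcdB m n)) ^ (m * b) = α ^ ((b : ℤ) * Nat.gcdB m n) := by
    rw [← hβ, ← zpow_natCast, ← zpow_natCast, ← zpow_mul, ← zpow_mul]
    congr 1; push_cast; ring
  rw [hl, mul_pow, h1, h2, ← zpow_add, hone, zpow_one]

theorem aux_chain {F : Type*} [Field F] (α : Fˣ)
    (hdiv : {n : ℕ | ∃ β : F, β ^ n = (α : F)}.Infinite) :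
    ∃ (n : ℕ → ℕ) (β : ℕ → Fˣ), (∀ k, 0 < n k) ∧ (∀ k, β k ^ n k = α) ∧
      (∀ k, n k ∣ n (k + 1)) ∧ (∀ k, 2 * n k ≤ n (k + 1)) := by
  let T := {m : ℕ // 0 < m ∧ ∃ β : Fˣ, β ^ m = α}
  have step : ∀ m : T, ∃ m' : T, m.1 ∣ m'.1 ∧ 2 * m.1 ≤ m'.1 := by
    rintro ⟨m, hm, β, hβ⟩
    obtain ⟨n, ⟨γ, hγ⟩, hn⟩ := hdiv.exists_gt m
    have hn0 : n ≠ 0 := by omega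
    have hγ0 : γ ≠ 0 := by
      rintro rfl
      rw [zero_pow hn0] at hγ
      exact α.ne_zero hγ.symm
    obtain ⟨δ, hδ⟩ := aux_lcm α m n hm β (Units.mk0 γ hγ0) hβ (by ext; simpa using hγ)
    have hlpos : 0 < Nat.lcm m n := Nat.lcm_pos hm (by omega)
    refine ⟨⟨Nat.lcm m n, hlpos, δ, hδ⟩, Nat.dvd_lcm_left m n, ?_⟩
    have hle : n ≤ Nat.lcm m n := Nat.le_of_dvd hlpos (Nat.dvd_lcm_right m n)
    obtain ⟨q, hq⟩ := Nat.dvd_lcm_left m n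
    show 2 * m ≤ Nat.lcm m n
    have : 2 ≤ q := by
      by_contra hlt
      have : q ≤ 1 := by omega
      have : m * q ≤ m * 1 := Nat.mul_le_mul_left m this
      omega
    rw [hq, mul_comm 2 m]
    exact Nat.mul_le_mul_left m this
  choose f hf1 hf2 using step
  let N : ℕ → T := fun k => f^[k] ⟨1, one_pos, α, pow_one α⟩
  have hN : ∀ k, N (k + 1) = f (N k) := fun k => Function.iterate_succ_apply' f k _
  refine ⟨fun k => (N k).1, fun k => (N k).2.2.choose, fun k => (N k).2.1,
    fun k => (N k).2.2.choose_spec, fun k => ?_, fun k => ?_⟩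
  · simp only [hN]; exact hf1 _
  · simp only [hN]; exact hf2 _

/-- Partial sums attached to a bit sequence. -/
def auxC (n : ℕ → ℕ) (s : ℕ → Bool) : ℕ → ℕ
  | 0 => 0
  | k + 1 => auxC n s k + if s k then n k else 0

theorem auxC_lt (n : ℕ → ℕ) (hpos : ∀ k, 0 < n k) (h2 : ∀ k, 2 * n k ≤ n (k + 1))
    (s : ℕ → Bool) (k : ℕ) : auxC n s k < n k := by
  induction k with
  | zero => exact hpos 0
  | succ k ih =>
    have := h2 k
    simp only [auxC]
    split_ifs <;> omega

theorem auxC_dvd (n : ℕ → ℕ) (hd : ∀ k, n k ∣ n (k + 1)) (s : ℕ → Bool) (j k : ℕ) (hjk : j ≤ k) :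
    ∃ q : ℕ, auxC n s k = auxC n s j + n j * q := by
  induction k, hjk using Nat.le_induction with
  | base => exact ⟨0, by simp⟩
  | succ k hk ih =>
    obtain ⟨q, hq⟩ := ih
    have hjk : n j ∣ n k := by
      clear hq
      induction k, hk using Nat.le_induction with
      | base => exact dvd_rfl
      | succ k hk ih => exact ih.trans (hd k)
    obtain ⟨r, hr⟩ := hjk
    simp only [auxC]
    split_ifs
    · exact ⟨q + r, by rw [hq, hr]; ring⟩
    · exact ⟨q, by rw [hq]; ring⟩

theorem auxC_inj (n : ℕ → ℕ) (hpos : ∀ k, 0 < n k) (s t : ℕ → Bool)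
    (h : ∀ k, auxC n s k = auxC n t k) : s = t := by
  funext k
  have h1 := h (k + 1)
  have h0 := h k
  have := hpos k
  simp only [auxC] at h1
  cases hs : s k <;> cases ht : t k <;> simp [hs, ht] at h1 ⊢ <;> omega

theorem aux_exp_inj (a b n : ℕ) (ha : a < n) (hb : b < n)
    (h : Circle.exp (2 * Real.pi * (a / n)) = Circle.exp (2 * Real.pi * (b / n))) : a = b := by
  obtain ⟨m, hm⟩ := Circle.exp_eq_exp.1 h
  have hn : (n : ℝ) ≠ 0 := by
    have : n ≠ 0 := by omega
    exact_mod_cast this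
  have hpi := Real.pi_pos.ne'
  have h1 : (a : ℝ) = b + m * n := by
    field_simp at hm
    linarith
  have h2 : (a : ℤ) = b + m * n := by exact_mod_cast h1
  have h3 : m = 0 := by
    have hn0 : (0 : ℤ) < n := by omega
    have hm1 : m < 1 := by
      by_contra hc
      have : 1 * (n : ℤ) ≤ m * n := by apply mul_le_mul_of_nonneg_right _ hn0.le; omega
      omega
    have hm2 : -1 < m := by
      by_contra hc
      have : m * (n : ℤ) ≤ -1 * n := by apply mul_le_mul_of_nonneg_right _ hn0.le; omega
      omega
    omega
  subst h3
  omega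

/-- Evaluation at an element of the base field, on the quotient. -/
def auxEv (K : Type*) (Fbar : Type*) [Field Fbar] [Field K] [Algebra K Fbar]
    (ι : (CommGroup.torsion Fbarˣ) →* Circle) (x : Kˣ) : XF K Fbar ι → Circle :=
  Quotient.lift (fun χ => χ.1 (Units.map (algebraMap K Fbar : K →* Fbar) x)) (by
    rintro χ₁ χ₂ ⟨σ, h⟩
    rw [h]
    congr 1
    ext
    simp)

theorem auxEv_continuous (K : Type*) (Fbar : Type*) [Field Fbar] [Field K] [Algebra K Fbar]
    (ι : (CommGroup.torsion Fbarˣ) →* Circle) (x : Kˣ) : Continuous (auxEv K Fbar ι x) := by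
  refine Continuous.quotient_lift ?_ _
  have h1 : Continuous (fun χ : Fbarˣ →* Circle => (χ : Fbarˣ → Circle)) :=
    continuous_induced_dom
  have h2 : Continuous (fun χ : XChar Fbar ι => χ.1) := continuous_subtype_val
  exact (continuous_apply _).comp (h1.comp h2)

theorem auxEv_pow (K : Type*) (Fbar : Type*) [Field Fbar] [Field K] [Algebra K Fbar]
    (ι : (CommGroup.torsion Fbarˣ) →* Circle) (x : Kˣ) (n : ℕ) (p : XF K Fbar ι) :
    auxEv K Fbar ι x p ^ n = auxEv K Fbar ι (x ^ n) p := by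
  induction p using Quotient.inductionOn with
  | h χ =>
    show χ.1 _ ^ n = χ.1 _
    rw [← map_pow, ← map_pow]

theorem aux_joined (K : Type*) (Fbar : Type*) [Field Fbar] [Field K] [Algebra K Fbar]
    (ι : (CommGroup.torsion Fbarˣ) →* Circle) (α : Kˣ) (p q : XF K Fbar ι) (h : Joined p q)
    (heq : auxEv K Fbar ι α p = auxEv K Fbar ι α q) :
    ∃ r : ℤ, ∀ (n : ℕ) (β : Kˣ), 0 < n → β ^ n = α →
      auxEv K Fbar ι β q = auxEv K Fbar ι β p * Circle.exp (r * (2 * Real.pi) / n) := by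
  obtain ⟨γ⟩ := h
  let ev : Kˣ → C(unitInterval, Circle) := fun x =>
    ⟨fun t => auxEv K Fbar ι x (γ t), (auxEv_continuous K Fbar ι x).comp γ.continuous⟩
  obtain ⟨R, hR⟩ := aux_displacement (ev α)
  have key : ∀ (n : ℕ) (β : Kˣ), 0 < n → β ^ n = α →
      auxEv K Fbar ι β q = auxEv K Fbar ι β p * Circle.exp (R / n) := by
    intro n β hn hβ
    have := hR n (ev β) hn (fun t => by
      show auxEv K Fbar ι β (γ t) ^ n = _
      rw [auxEv_pow, hβ]; rfl)
    simpa [ev] using this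
  have h1 := key 1 α one_pos (pow_one α)
  rw [← heq] at h1
  have h2 : Circle.exp R = 1 := by simpa using h1
  obtain ⟨r, rfl⟩ := Circle.exp_eq_one.1 h2
  exact ⟨r, key⟩

/-- If `F` (a field of characteristic `0` containing all roots of unity) has an element
`α ∈ Fˣ` of infinite order admitting `n`-th roots in `F` for infinitely many `n`, then
`X_F` has uncountably many path components. -/
theorem XF_uncountably_many_path_components (F Fbar : Type*) [Field F] [CharZero F]
    [Field Fbar] [Algebra F Fbar] [IsAlgClosure F Fbar]
    (hroots : ∀ n : ℕ, 0 < n → ∃ ζ : F, IsPrimitiveRoot ζ n)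
    (ι : (CommGroup.torsion Fbarˣ) →* Circle) (hι : Function.Injective ι)
    (α : Fˣ) (hα : ¬ IsOfFinOrder α)
    (hdiv : {n : ℕ | ∃ β : F, β ^ n = (α : F)}.Infinite) :
    ¬ Countable (ZerothHomotopy (XF F Fbar ι)) := by
  classical
  obtain ⟨n, β, hpos, hβ, hd, h2⟩ := aux_chain α hdiv
  obtain ⟨χ₀, hχ₀⟩ := aux_extend (CommGroup.torsion Fbarˣ) ι
  let φ : Fˣ →* Fbarˣ := Units.map (algebraMap F Fbar : F →* Fbar)
  have hφ : Function.Injective φ := Units.map_injective (algebraMap F Fbar).injective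
  have hα' : ¬ IsOfFinOrder (φ α) := by rwa [hφ.isOfFinOrder_iff]
  obtain ⟨l, hl⟩ := aux_functional (φ α) hα'
  choose ψ hψ using fun s : ℕ → Bool => aux_limit_char l (auxC n s)
  have hlβ : ∀ k, l (Additive.ofMul (φ (β k))) = 1 / n k := by
    intro k
    have h := hl
    rw [← hβ k, map_pow, ofMul_pow, map_nsmul, nsmul_eq_mul] at h
    have : (n k : ℚ) ≠ 0 := by exact_mod_cast (hpos k).ne'
    field_simp
    linarith
  have hψβ : ∀ s k, ψ s (φ (β k)) = Circle.exp (2 * Real.pi * (auxC n s k / n k)) := by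
    intro s k
    refine hψ s _ _ k (fun i hi => ?_)
    obtain ⟨q, hq⟩ := auxC_dvd n hd s k i hi
    rw [hlβ, hq, Circle.exp_eq_exp]
    refine ⟨q, ?_⟩
    have : (n k : ℝ) ≠ 0 := by exact_mod_cast (hpos k).ne'
    push_cast
    field_simp
  have hψα : ∀ s, ψ s (φ α) = 1 := by
    intro s
    refine hψ s _ _ 0 (fun i _ => ?_)
    rw [hl, Circle.exp_eq_one]
    exact ⟨auxC n s i, by push_cast; ring⟩
  have hψt : ∀ s (ζ : CommGroup.torsion Fbarˣ), ψ s ζ = 1 := by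
    intro s ζ
    refine hψ s _ _ 0 (fun i _ => ?_)
    have hz : l (Additive.ofMul (ζ : Fbarˣ)) = 0 := by
      obtain ⟨m, hm, hζ⟩ := isOfFinOrder_iff_pow_eq_one.1 ζ.2
      have h : l (Additive.ofMul ((ζ : Fbarˣ) ^ m)) = 0 := by rw [hζ]; simp
      rw [ofMul_pow, map_nsmul, nsmul_eq_mul] at h
      have : (m : ℚ) ≠ 0 := by exact_mod_cast hm.ne'
      exact (mul_eq_zero.1 h).resolve_left this
    rw [hz]; simp
  let χ : (ℕ → Bool) → XChar Fbar ι := fun s =>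
    ⟨χ₀ * ψ s, fun ζ => by rw [MonoidHom.mul_apply, hψt, mul_one, hχ₀]⟩
  let P : (ℕ → Bool) → XF F Fbar ι := fun s => Quotient.mk _ (χ s)
  have hP : ∀ s x, auxEv F Fbar ι x (P s) = χ₀ (φ x) * ψ s (φ x) := fun s x => rfl
  intro hcount
  let cl : (ℕ → Bool) → ZerothHomotopy (XF F Fbar ι) := fun s => ZerothHomotopy.mk (P s)
  let rep : (ℕ → Bool) → (ℕ → Bool) := fun s =>
    Function.invFun cl (cl s)
  have hrep : ∀ s, cl (rep s) = cl s := fun s => Function.invFun_eq ⟨s, rfl⟩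
  have hj : ∀ s, Joined (P (rep s)) (P s) := fun s => Quotient.exact (hrep s)
  choose r hr using fun s => aux_joined F Fbar ι α (P (rep s)) (P s) (hj s)
    (by rw [hP, hP, hψα, hψα])
  have hinj : Function.Injective (fun s => (cl s, r s)) := by
    intro s t hst
    have hc : cl s = cl t := congrArg Prod.fst hst
    have hrr : r s = r t := congrArg Prod.snd hst
    have hre : rep s = rep t := by simp only [rep, hc]
    refine auxC_inj n hpos s t (fun k => ?_)
    refine aux_exp_inj _ _ (n k) (auxC_lt n hpos h2 s k) (auxC_lt n hpos h2 t k) ?_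
    rw [← hψβ, ← hψβ]
    have h1 := hr s (n k) (β k) (hpos k) (hβ k)
    have h3 := hr t (n k) (β k) (hpos k) (hβ k)
    rw [hre, hrr, ← h3, hP, hP] at h1
    exact mul_left_cancel h1
  have hcb : Countable (ℕ → Bool) := hinj.countable
  obtain ⟨e, he⟩ := exists_injective_nat (ℕ → Bool)
  refine Function.cantor_injective (fun S : Set ℕ => e (fun i => decide (i ∈ S))) ?_
  intro S T hST
  ext i
  have := congrFun (he hST) i
  simpa using this

end
end

section
/- Let F be a field which is an algebraic extension of ℚ, contains a primitive n-th root of unity for every n ≥ 1, and admits a subfield K with [K : ℚ] finite such that F/K is a Galois extension with abelian Galois group. Then F is stably multiplicatively free: for every finite field extension E of F, the quotient group Eˣ/μ(E) of the multiplicative group of E by its torsion subgroup (its group of roots of unity) is a free abelian group. -/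
theorem smf_step {A : Type*} [AddCommGroup A]
    (h : ∀ s : Set A, s.Finite → ∃ P : Submodule ℤ A, P.FG ∧ s ⊆ P ∧
      ∀ (n : ℤ) (a : A), n ≠ 0 → n • a ∈ P → a ∈ P)
    (s : Set A) (hs : s.Finite) (hli : LinearIndepOn ℤ id s)
    (hp : ∀ (n : ℤ) (a : A), n ≠ 0 → n • a ∈ Submodule.span ℤ s → a ∈ Submodule.span ℤ s)
    (a : A) :
    ∃ t : Set A, t.Finite ∧ LinearIndepOn ℤ id t ∧
      (∀ (n : ℤ) (a : A), n ≠ 0 → n • a ∈ Submodule.span ℤ t → a ∈ Submodule.span ℤ t) ∧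
      s ⊆ t ∧ a ∈ Submodule.span ℤ t := by
  obtain ⟨P, hPfg, hsP, hPp⟩ := h (insert a s) (hs.insert a)
  set Q := Submodule.span ℤ s with hQ
  have hQP : Q ≤ P := Submodule.span_le.2 (fun x hx => hsP (Set.mem_insert_of_mem _ hx))
  have htf : Module.IsTorsionFree ℤ (A ⧸ Q) := by
    rw [Module.isTorsionFree_iff_smul_eq_zero]
    intro n x hx
    obtain ⟨x, rfl⟩ := Q.mkQ_surjective x
    by_cases hn : n = 0
    · exact Or.inl hn
    · right
      rw [← map_smul, Submodule.mkQ_apply, Submodule.Quotient.mk_eq_zero] at hx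
      rw [Submodule.mkQ_apply, Submodule.Quotient.mk_eq_zero]
      exact hp n x hn hx
  let N := P.map Q.mkQ
  have hNf : Module.Finite ℤ N := Module.Finite.iff_fg.2 (hPfg.map _)
  have hNfree : Module.Free ℤ N := inferInstance
  let b := Module.Free.chooseBasis ℤ N
  have hl : ∀ i, ∃ v ∈ P, Q.mkQ v = (b i : A ⧸ Q) := fun i => (b i).2
  choose v hvP hv using hl
  have hvli : LinearIndependent ℤ (Submodule.Quotient.mk (p := Q) ∘ v) := by
    have : (Submodule.Quotient.mk (p := Q) ∘ v) = fun i => (b i : A ⧸ Q) := by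
      funext i; exact hv i
    rw [this]
    exact b.linearIndependent.map' N.subtype N.ker_subtype
  have hvr : LinearIndepOn ℤ (Submodule.Quotient.mk (p := Q)) (Set.range v) := by
    have hinj : Function.Injective v := fun i j hij => hvli.injective (by simp [hij])
    exact (linearIndepOn_range_iff hinj _).2 hvli
  have hspan : Submodule.span ℤ (s ∪ Set.range v) = P := by
    apply le_antisymm
    · rw [Submodule.span_le]
      rintro x (hx | ⟨i, rfl⟩)
      · exact hsP (Set.mem_insert_of_mem _ hx)
      · exact hvP i
    · intro x hx
      have hx' : (⟨Q.mkQ x, Submodule.mem_map_of_mem hx⟩ : N) ∈ Submodule.span ℤ (Set.range b) := by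
        rw [b.span_eq]; trivial
      have h2 := Submodule.mem_map_of_mem (f := N.subtype) hx'
      rw [Submodule.map_span, ← Set.range_comp] at h2
      have h3 : (N.subtype ∘ b) = Q.mkQ ∘ v := by
        funext i; exact (hv i).symm
      rw [h3, Set.range_comp, ← Submodule.map_span] at h2
      obtain ⟨y, hy, hyx⟩ := h2
      have h4 : x - y ∈ Q := by
        rw [← Submodule.Quotient.mk_eq_zero, ← Submodule.mkQ_apply, map_sub, hyx]
        simp
      rw [Submodule.span_union, ← sub_add_cancel x y]
      exact Submodule.add_mem_sup h4 hy
  refine ⟨s ∪ Set.range v, hs.union (Set.finite_range v),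
    LinearIndepOn.union_id_of_quotient Submodule.subset_span hli hvr, ?_, Set.subset_union_left, ?_⟩
  · rw [hspan]; exact hPp
  · rw [hspan]; exact hsP (Set.mem_insert _ _)

theorem smf_free {A : Type*} [AddCommGroup A] [Countable A] [Module.IsTorsionFree ℤ A]
    (h : ∀ s : Set A, s.Finite → ∃ P : Submodule ℤ A, P.FG ∧ s ⊆ P ∧
      ∀ (n : ℤ) (a : A), n ≠ 0 → n • a ∈ P → a ∈ P) : Module.Free ℤ A := by
  obtain ⟨e, he⟩ := exists_surjective_nat A
  let T := {s : Set A // s.Finite ∧ LinearIndepOn ℤ id s ∧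
    (∀ (n : ℤ) (a : A), n ≠ 0 → n • a ∈ Submodule.span ℤ s → a ∈ Submodule.span ℤ s)}
  have hstep : ∀ (s : T) (a : A), ∃ t : T, s.1 ⊆ t.1 ∧ a ∈ Submodule.span ℤ t.1 := by
    rintro ⟨s, h1, h2, h3⟩ a
    obtain ⟨t, a1, a2, a3, a4, a5⟩ := smf_step h s h1 h2 h3 a
    exact ⟨⟨t, a1, a2, a3⟩, a4, a5⟩
  choose g hg1 hg2 using hstep
  let s0 : T := ⟨∅, Set.finite_empty, linearIndepOn_empty _ _, by
    intro n a hn ha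
    simp only [Submodule.span_empty, Submodule.mem_bot] at ha ⊢
    exact (smul_eq_zero.1 ha).resolve_left hn⟩
  let B : ℕ → T := fun n => Nat.rec s0 (fun k t => g t (e k)) n
  have hB : ∀ n, B (n+1) = g (B n) (e n) := fun n => rfl
  have hmono : Monotone (fun n => (B n).1) := monotone_nat_of_le_succ (fun n => by
    show (B n).1 ⊆ (B (n+1)).1
    rw [hB]; exact hg1 _ _)
  have hli : LinearIndepOn ℤ id (⋃ n, (B n).1) :=
    linearIndepOn_iUnion_of_directed hmono.directed_le (fun n => (B n).2.2.1)
  have hsp : ⊤ ≤ Submodule.span ℤ (Set.range (fun x : (⋃ n, (B n).1) => id (x : A))) := by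
    intro x _
    obtain ⟨n, rfl⟩ := he x
    have h1 : e n ∈ Submodule.span ℤ (B (n+1)).1 := by rw [hB]; exact hg2 _ _
    refine Submodule.span_mono ?_ h1
    simp only [id, Subtype.range_coe]
    exact Set.subset_iUnion (fun n => (B n).1) (n+1)
  exact Module.Free.of_basis (Module.Basis.mk hli hsp)

/-- criterion with an auxiliary target -/
theorem smf_free' {A : Type*} [AddCommGroup A] [Countable A] [Module.IsTorsionFree ℤ A]
    {B : Type*} [AddCommGroup B] (f : A →ₗ[ℤ] B) (hf : Function.Injective f)
    (h : ∀ s : Set A, s.Finite → ∃ (Q : Submodule ℤ B) (W : ℤ), Q.FG ∧ W ≠ 0 ∧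
      ∀ (n : ℤ) (a : A), n ≠ 0 → n • a ∈ Submodule.span ℤ s → W • f a ∈ Q) :
    Module.Free ℤ A := by
  refine smf_free (fun s hs => ?_)
  obtain ⟨Q, W, hQ, hW, hh⟩ := h s hs
  let P : Submodule ℤ A :=
    { carrier := {a | ∃ n : ℤ, n ≠ 0 ∧ n • a ∈ Submodule.span ℤ s}
      zero_mem' := ⟨1, one_ne_zero, by simp⟩
      add_mem' := by
        rintro a b ⟨n, hn, ha⟩ ⟨m, hm, hb⟩
        refine ⟨n * m, mul_ne_zero hn hm, ?_⟩
        rw [smul_add]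
        refine Submodule.add_mem _ ?_ ?_
        · rw [mul_comm, mul_smul]; exact Submodule.smul_mem _ _ ha
        · rw [mul_smul]; exact Submodule.smul_mem _ _ hb
      smul_mem' := by
        rintro c a ⟨n, hn, ha⟩
        refine ⟨n, hn, ?_⟩
        rw [smul_comm]; exact Submodule.smul_mem _ _ ha }
  have hP : ∀ a, a ∈ P ↔ ∃ n : ℤ, n ≠ 0 ∧ n • a ∈ Submodule.span ℤ s := fun a => Iff.rfl
  refine ⟨P, ?_, ?_, ?_⟩
  · have hQf : Module.Finite ℤ Q := Module.Finite.iff_fg.2 hQ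
    let g : P →ₗ[ℤ] Q := LinearMap.codRestrict Q ((W • f).comp P.subtype) (by
      rintro ⟨a, n, hn, ha⟩
      exact hh n a hn ha)
    have hg : Function.Injective g := by
      rw [← LinearMap.ker_eq_bot, LinearMap.ker_eq_bot']
      intro a ha
      have h1 : W • f a = 0 := congrArg Subtype.val ha
      rw [← map_smul] at h1
      have h2 : W • (a : A) = 0 := hf (by rw [h1, map_zero])
      exact Subtype.ext ((smul_eq_zero.1 h2).resolve_left hW)
    exact Module.Finite.iff_fg.1 (Module.Finite.of_injective g hg)
  · intro a ha
    exact ⟨1, one_ne_zero, by simpa using Submodule.subset_span ha⟩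
  · rintro n a hn ⟨m, hm, ha⟩
    exact ⟨m * n, mul_ne_zero hm hn, by rwa [mul_smul]⟩

open IsDedekindDomain NumberField in
/-- finitely generated root-closed subgroups (`S`-units) -/
theorem smf_sunits (L : Type*) [Field L] [NumberField L] (s : Set Lˣ) (hs : s.Finite) :
    ∃ U : Subgroup Lˣ, (AddSubgroup.toIntSubmodule U.toAddSubgroup).FG ∧ s ⊆ U ∧
      ∀ (n : ℕ) (x : Lˣ), n ≠ 0 → x ^ n ∈ U → x ∈ U := by
  let S : Set (HeightOneSpectrum (𝓞 L)) :=
    ⋃ x ∈ s, (HeightOneSpectrum.Support (𝓞 L) (x : L) ∪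
      HeightOneSpectrum.Support (𝓞 L) ((x⁻¹ : Lˣ) : L))
  have hS : S.Finite := hs.biUnion (fun x _ =>
    (HeightOneSpectrum.Support.finite _ _).union (HeightOneSpectrum.Support.finite _ _))
  have hmem : ∀ x : Lˣ, x ∈ S.unit L ↔ ∀ v, v ∉ S → v.valuation L (x : L) = 1 :=
    fun x => Iff.rfl
  refine ⟨S.unit L, ?_, ?_, ?_⟩
  · have : Fintype S := hS.fintype
    let f : Additive Lˣ →ₗ[ℤ] (S → ℤ) :=
      LinearMap.pi (fun v => (MonoidHom.toAdditiveLeft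
        (HeightOneSpectrum.valuationOfNeZero (K := L) v.1)).toIntLinearMap)
    apply Submodule.fg_of_fg_map_of_fg_inf_ker f
    · exact IsNoetherian.noetherian _
    · let g : Additive (𝓞 L)ˣ →ₗ[ℤ] Additive Lˣ :=
        (MonoidHom.toAdditive (Units.map (algebraMap (𝓞 L) L).toMonoidHom)).toIntLinearMap
      have hgf : (LinearMap.range g).FG := by
        rw [LinearMap.range_eq_map]; exact Module.Finite.fg_top.map _
      have : IsNoetherian ℤ (LinearMap.range g) := isNoetherian_of_fg_of_noetherian _ hgf
      refine Submodule.FG.of_le hgf ?_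
      rintro x ⟨hx1, hx2⟩
      have hx1 : ∀ v, v ∉ S → v.valuation L (x.toMul : L) = 1 := hx1
      have hx2 : ∀ v : S, HeightOneSpectrum.valuationOfNeZero (K := L) v.1 x.toMul = 1 := by
        intro v
        exact congrFun (LinearMap.mem_ker.1 hx2) v
      have hx3 : ∀ v : HeightOneSpectrum (𝓞 L), v.valuation L (x.toMul : L) = 1 := by
        intro v
        by_cases hv : v ∈ S
        · rw [← HeightOneSpectrum.valuationOfNeZero_eq, hx2 ⟨v, hv⟩]; rfl
        · exact hx1 v hv
      obtain ⟨y, hy⟩ := HeightOneSpectrum.mem_integers_of_valuation_le_one L (x.toMul : L)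
        (fun v => (hx3 v).le)
      obtain ⟨z, hz⟩ := HeightOneSpectrum.mem_integers_of_valuation_le_one L
        ((x.toMul⁻¹ : Lˣ) : L) (fun v => by rw [Units.val_inv_eq_inv_val, map_inv₀, hx3]; simp)
      have hyz : y * z = 1 := by
        apply FaithfulSMul.algebraMap_injective (𝓞 L) L
        rw [map_mul, hy, hz]; simp
      refine ⟨Additive.ofMul (Units.mk y z hyz (by rw [mul_comm, hyz])), ?_⟩
      apply Additive.toMul.injective
      ext
      exact hy
  · intro x hx v hv
    have h1 : v ∉ HeightOneSpectrum.Support (𝓞 L) (x : L) := fun h => hv <|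
      Set.mem_biUnion hx (Or.inl h)
    have h2 : v ∉ HeightOneSpectrum.Support (𝓞 L) ((x⁻¹ : Lˣ) : L) := fun h => hv <|
      Set.mem_biUnion hx (Or.inr h)
    have h1 : v.valuation L (x : L) ≤ 1 := not_lt.1 h1
    have h2 : v.valuation L ((x⁻¹ : Lˣ) : L) ≤ 1 := not_lt.1 h2
    refine eq_one_of_one_le_mul_left h1 h2 (le_of_eq ?_)
    rw [← map_mul]; simp
  · intro n x hn hx v hv
    have h1 : v.valuation L ((x ^ n : Lˣ) : L) = 1 := hx v hv
    rw [Units.val_pow_eq_pow_val, map_pow] at h1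
    exact (pow_eq_one_iff.1 h1).resolve_right hn

theorem smf_group {G H : Type*} [CommGroup G] [CommGroup H] [Countable G] (φ : G →* H)
    (hφ : Function.Injective φ)
    (h : ∀ s : Set G, s.Finite → ∃ (U : Subgroup H) (W : ℕ),
      (AddSubgroup.toIntSubmodule U.toAddSubgroup).FG ∧ W ≠ 0 ∧
      ∀ (x : G) (m : ℕ), m ≠ 0 → x ^ m ∈ Subgroup.closure s →
        ∃ u ∈ U, ∃ k : ℕ, k ≠ 0 ∧ (φ x ^ W) ^ k = u ^ k) :
    Module.Free ℤ (Additive (G ⧸ CommGroup.torsion G)) := by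
  have : Countable (G ⧸ CommGroup.torsion G) := (QuotientGroup.mk_surjective).countable
  have : Countable (Additive (G ⧸ CommGroup.torsion G)) := this
  have hle : CommGroup.torsion G ≤ (CommGroup.torsion H).comap φ := by
    intro x hx
    exact φ.isOfFinOrder hx
  let f0 : G ⧸ CommGroup.torsion G →* H ⧸ CommGroup.torsion H := QuotientGroup.map _ _ φ hle
  have hf0 : Function.Injective f0 := by
    rw [injective_iff_map_eq_one]
    intro a ha
    obtain ⟨x, rfl⟩ := QuotientGroup.mk_surjective a
    have h1 : ((φ x : H) : H ⧸ CommGroup.torsion H) = 1 := ha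
    rw [QuotientGroup.eq_one_iff] at h1 ⊢
    exact (hφ.isOfFinOrder_iff (f := φ)).1 h1
  have htf : ∀ (x : G) (n : ℕ), n ≠ 0 →
      ((x : G ⧸ CommGroup.torsion G)) ^ n = 1 → (x : G ⧸ CommGroup.torsion G) = 1 := by
    intro x n hn hx
    rw [← QuotientGroup.mk_pow, QuotientGroup.eq_one_iff] at hx
    rw [QuotientGroup.eq_one_iff]
    exact IsOfFinOrder.of_pow (n := n) hx hn
  have : Module.IsTorsionFree ℤ (Additive (G ⧸ CommGroup.torsion G)) := by
    rw [Module.isTorsionFree_iff_smul_eq_zero]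
    intro n a ha
    by_cases hn : n = 0
    · exact Or.inl hn
    right
    obtain ⟨x, hx⟩ := QuotientGroup.mk_surjective a.toMul
    have ha' : (n.natAbs : ℤ) • a = 0 := by
      rcases Int.natAbs_eq n with h | h
      · rw [← h, ha]
      · have h2 : (n.natAbs : ℤ) = - n := by omega
        rw [h2, neg_smul, ha, neg_zero]
    rw [natCast_zsmul] at ha'
    have h2 : ((x : G ⧸ CommGroup.torsion G)) ^ n.natAbs = 1 := by
      rw [hx]; exact ha'
    have h3 := htf x _ (Int.natAbs_ne_zero.2 hn) h2
    rw [hx] at h3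
    exact h3
  refine smf_free' (B := Additive (H ⧸ CommGroup.torsion H))
    (MonoidHom.toAdditive f0).toIntLinearMap hf0 ?_
  intro s hs
  let o : Additive (G ⧸ CommGroup.torsion G) → G := fun a => Quotient.out a.toMul
  have ho : ∀ a, ((o a : G) : G ⧸ CommGroup.torsion G) = a.toMul := fun a =>
    QuotientGroup.out_eq' _
  obtain ⟨U, W, hU, hW, hh⟩ := h (o '' s) (hs.image o)
  let p : Additive H →ₗ[ℤ] Additive (H ⧸ CommGroup.torsion H) :=
    (MonoidHom.toAdditive (QuotientGroup.mk' (CommGroup.torsion H))).toIntLinearMap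
  refine ⟨(AddSubgroup.toIntSubmodule U.toAddSubgroup).map p, W, hU.map p, by exact_mod_cast hW, ?_⟩
  intro n a hn ha
  -- lift membership
  have hspan : ∀ b ∈ Submodule.span ℤ s, ∃ y ∈ Subgroup.closure (o '' s),
      ((y : G) : G ⧸ CommGroup.torsion G) = b.toMul := by
    intro b hb
    induction hb using Submodule.span_induction with
    | mem b hb => exact ⟨o b, Subgroup.subset_closure ⟨b, hb, rfl⟩, ho b⟩
    | zero => exact ⟨1, one_mem _, rfl⟩
    | add b c _ _ hb hc =>
      obtain ⟨y, hy, hy'⟩ := hb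
      obtain ⟨z, hz, hz'⟩ := hc
      exact ⟨y * z, mul_mem hy hz, by rw [QuotientGroup.mk_mul, hy', hz']; rfl⟩
    | smul r b _ hb =>
      obtain ⟨y, hy, hy'⟩ := hb
      exact ⟨y ^ r, zpow_mem hy r, by rw [QuotientGroup.mk_zpow, hy']; rfl⟩
  have ha' : n.natAbs • a ∈ Submodule.span ℤ s := by
    rw [← natCast_zsmul]
    rcases Int.natAbs_eq n with h | h
    · rwa [← h]
    · have h2 : (n.natAbs : ℤ) = - n := by omega
      rw [h2, neg_smul]; exact Submodule.neg_mem _ ha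
  obtain ⟨y, hy, hy'⟩ := hspan _ ha'
  obtain ⟨x, hx⟩ := QuotientGroup.mk_surjective a.toMul
  have h1 : ((y : G) : G ⧸ CommGroup.torsion G) = ((x ^ n.natAbs : G) : G ⧸ CommGroup.torsion G) := by
    rw [hy', QuotientGroup.mk_pow, hx]; rfl
  rw [QuotientGroup.eq] at h1
  obtain ⟨k, hk, hk'⟩ := isOfFinOrder_iff_pow_eq_one.1 h1
  have h2 : x ^ (n.natAbs * k) = y ^ k := by
    rw [mul_pow, inv_pow, inv_mul_eq_one] at hk'
    rw [pow_mul, ← hk']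
  obtain ⟨u, hu, j, hj, huj⟩ := hh x (n.natAbs * k)
    (mul_ne_zero (Int.natAbs_ne_zero.2 hn) hk.ne') (by rw [h2]; exact pow_mem hy k)
  refine ⟨Additive.ofMul u, hu, ?_⟩
  have h3 : ((u : H) : H ⧸ CommGroup.torsion H) = ((φ x ^ W : H) : H ⧸ CommGroup.torsion H) := by
    rw [QuotientGroup.eq]
    refine isOfFinOrder_iff_pow_eq_one.2 ⟨j, Nat.pos_of_ne_zero hj, ?_⟩
    rw [mul_pow, inv_pow, inv_mul_eq_one, huj]
  have h4 : f0 a.toMul = ((φ x : H) : H ⧸ CommGroup.torsion H) := by rw [← hx]; rfl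
  have h5 : ((u : H) : H ⧸ CommGroup.torsion H) = (f0 a.toMul) ^ W := by
    rw [h3, h4]; rfl
  rw [natCast_zsmul]
  exact h5

theorem smf_key (L Ω : Type*) [Field L] [NumberField L] [Field Ω] [CharZero Ω] [Algebra L Ω]
    [IsAlgClosed Ω] [Algebra.IsAlgebraic L Ω] (x : Ωˣ)
    (hx : ∀ σ τ : Ω ≃ₐ[L] Ω, σ (τ x) = τ (σ x)) (m : ℕ) (hm : m ≠ 0)
    (hxm : ∃ l : Lˣ, x ^ m = Units.map (algebraMap L Ω).toMonoidHom l) :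
    ∃ (l : Lˣ) (k : ℕ), k ≠ 0 ∧ (x ^ NumberField.Units.torsionOrder L) ^ k =
      (Units.map (algebraMap L Ω).toMonoidHom l) ^ k := by
  have : IsAlgClosure L Ω := ⟨inferInstance, inferInstance⟩
  have : Normal L Ω := IsAlgClosure.normal L Ω
  have : IsGalois L Ω := ⟨⟩
  set ι : Lˣ →* Ωˣ := Units.map (algebraMap L Ω).toMonoidHom with hι
  have hfix : ∀ y : Ωˣ, (∀ σ : Ω ≃ₐ[L] Ω, σ y = y) → ∃ l, ι l = y := by
    intro y hy
    obtain ⟨l, hl⟩ := (InfiniteGalois.mem_range_algebraMap_iff_fixed (k := L) (y : Ω)).2 hy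
    have hl0 : l ≠ 0 := by
      rintro rfl
      exact y.ne_zero (by rw [← hl, map_zero])
    exact ⟨Units.mk0 l hl0, Units.ext hl⟩
  let V : Subgroup Ωˣ := ι.range ⊔ CommGroup.torsion Ωˣ
  have hιV : ∀ l, ι l ∈ V := fun l => Subgroup.mem_sup_left ⟨l, rfl⟩
  set g := orderOf (x : Ωˣ ⧸ V) with hg
  have hgk : ∀ k : ℤ, (g : ℤ) ∣ k ↔ x ^ k ∈ V := by
    intro k
    rw [hg, orderOf_dvd_iff_zpow_eq_one, ← QuotientGroup.mk_zpow, QuotientGroup.eq_one_iff]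
  have hgm : g ∣ m := by
    have := (hgk m).2 (by
      obtain ⟨l, hl⟩ := hxm
      rw [zpow_natCast, hl]; exact hιV l)
    exact_mod_cast this
  have hg0 : g ≠ 0 := fun h => hm (by rw [h] at hgm; exact zero_dvd_iff.1 hgm)
  have : NeZero m := ⟨hm⟩
  have : NeZero g := ⟨hg0⟩
  have : NeZero (m : Ω) := ⟨by exact_mod_cast hm⟩
  obtain ⟨ζ, hζ⟩ := HasEnoughRootsOfUnity.exists_primitiveRoot Ω m
  obtain ⟨d, hd⟩ := hgm
  have hξ : IsPrimitiveRoot (ζ ^ d) g := hζ.pow (Nat.pos_of_ne_zero hm) (by rw [hd, mul_comm])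
  have hc : ∀ τ : Ω ≃ₐ[L] Ω, τ (ζ ^ d) = ζ ^ d := by
    intro τ
    obtain ⟨c, -, hc⟩ := hζ.eq_pow_of_pow_eq_one (ξ := τ ζ)
      (by rw [← map_pow, hζ.pow_eq_one, map_one])
    have hroot : ∀ η : Ω, η ^ m = 1 → τ η = η ^ c := by
      intro η hη
      obtain ⟨i, -, rfl⟩ := hζ.eq_pow_of_pow_eq_one hη
      rw [map_pow, ← hc, ← pow_mul, ← pow_mul, mul_comm]
    have hσx : ∀ σ : Ω ≃ₐ[L] Ω, (σ x) ^ m = x ^ m := by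
      intro σ
      obtain ⟨l, hl⟩ := hxm
      have : (x : Ω) ^ m = algebraMap L Ω l := by
        have := congrArg Units.val hl
        rw [Units.val_pow_eq_pow_val] at this
        exact this
      rw [← map_pow, this, AlgEquiv.commutes]
    have hτx0 : τ x ≠ 0 := by simp
    let τx : Ωˣ := Units.mk0 (τ x) hτx0
    obtain ⟨l, hl⟩ := hfix (τx / x ^ c) (by
      intro σ
      have h0 : (σ x / x : Ω) ^ m = 1 := by
        rw [div_pow, hσx, div_self]; exact pow_ne_zero _ x.ne_zero
      have h1 := hroot _ h0
      have hs0 : σ x ≠ 0 := by simp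
      rw [map_div₀, ← hx σ τ] at h1
      rw [Units.val_div_eq_div_val, Units.val_pow_eq_pow_val]
      simp only [τx, Units.val_mk0, map_div₀, map_pow]
      have hx0 := x.ne_zero
      rw [div_pow, div_eq_div_iff hτx0 (pow_ne_zero _ hx0)] at h1
      rw [div_eq_div_iff (pow_ne_zero _ hs0) (pow_ne_zero _ hx0), h1, mul_comm])
    have hη : τx / x ∈ CommGroup.torsion Ωˣ := by
      refine isOfFinOrder_iff_pow_eq_one.2 ⟨m, Nat.pos_of_ne_zero hm, ?_⟩
      rw [div_pow, div_eq_one]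
      ext
      exact hσx τ
    have hV : x ^ ((c : ℤ) - 1) ∈ V := by
      have : x ^ ((c : ℤ) - 1) = (τx / x) * (ι l)⁻¹ := by
        rw [hl, zpow_sub, zpow_natCast, zpow_one]
        simp only [div_eq_mul_inv, mul_inv, inv_inv]
        rw [mul_comm τx, mul_assoc, mul_inv_cancel_left, mul_comm]
      rw [this]
      exact mul_mem (Subgroup.mem_sup_right hη) (inv_mem (hιV l))
    have hdvd := (hgk _).2 hV
    rw [hroot _ (by rw [← pow_mul, mul_comm, pow_mul, hζ.pow_eq_one, one_pow])]
    have h2 := (hξ.zpow_eq_one_iff_dvd _).2 hdvd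
    have hξ0 : ζ ^ d ≠ 0 := hξ.ne_zero hg0
    rw [zpow_sub₀ hξ0, zpow_natCast, zpow_one, div_eq_one_iff_eq hξ0] at h2
    exact h2
  obtain ⟨ξ, hξ'⟩ := (InfiniteGalois.mem_range_algebraMap_iff_fixed (k := L) (ζ ^ d)).2 hc
  rw [← hξ'] at hξ
  have hξL : IsPrimitiveRoot ξ g := hξ.of_map_of_injective (algebraMap L Ω).injective
  have hW : g ∣ NumberField.Units.torsionOrder L :=
    NumberField.Units.dvd_torsionOrder_of_isPrimitiveRoot hξL
  have hWV : x ^ (NumberField.Units.torsionOrder L) ∈ V := by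
    rw [← zpow_natCast, ← hgk]; exact_mod_cast hW
  obtain ⟨_, ⟨l, rfl⟩, t, ht, hlt⟩ := Subgroup.mem_sup.1 hWV
  obtain ⟨k, hk, hk'⟩ := isOfFinOrder_iff_pow_eq_one.1 ht
  exact ⟨l, k, hk.ne', by rw [← hlt, mul_pow, hk', mul_one]⟩

theorem smf_comm (F : Type*) [Field F] [CharZero F] (K : IntermediateField ℚ F)
    [IsGalois K F] (habelian : ∀ σ τ : F ≃ₐ[K] F, σ * τ = τ * σ)
    (Ω L : Type*) [Field Ω] [Field L] [Algebra F Ω] [Algebra L Ω]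
    (hKL : ∀ k : K, algebraMap F Ω k ∈ Set.range (algebraMap L Ω))
    (σ τ : Ω ≃ₐ[L] Ω) (y : F) :
    σ (τ (algebraMap F Ω y)) = τ (σ (algebraMap F Ω y)) := by
  let r : (Ω ≃ₐ[L] Ω) → (Ω ≃ₐ[K] Ω) := fun σ => AlgEquiv.ofRingEquiv (f := σ.toRingEquiv)
    (fun k => by
      obtain ⟨l, hl⟩ := hKL k
      have h1 : algebraMap K Ω k = algebraMap L Ω l := hl.symm
      rw [h1]
      exact σ.commutes l)
  have hr : ∀ (σ : Ω ≃ₐ[L] Ω) (y : F),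
      σ (algebraMap F Ω y) = algebraMap F Ω ((r σ).restrictNormal F y) := fun σ y =>
    ((r σ).restrictNormal_commutes F y).symm
  rw [hr τ, hr σ, hr σ, hr τ]
  congr 1
  exact DFunLike.congr_fun (habelian ((r σ).restrictNormal F) ((r τ).restrictNormal F)) y

/-- Let `F` be an algebraic extension of `ℚ` containing a primitive `n`-th root of unity
for every `n ≥ 1`, and suppose that `F` is an abelian Galois extension of some subfield
`K` which is finite over `ℚ`.  Then `F` is stably multiplicatively free: for every finite
field extension `E` of `F`, the group `Eˣ` modulo its torsion subgroup (its roots of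
unity) is a free abelian group. -/
theorem stably_multiplicatively_free (F : Type*) [Field F] [CharZero F]
    [Algebra.IsAlgebraic ℚ F]
    (hroots : ∀ n : ℕ, 0 < n → ∃ ζ : F, IsPrimitiveRoot ζ n)
    (K : IntermediateField ℚ F) (hKfin : FiniteDimensional ℚ K)
    (hgal : IsGalois K F) (habelian : ∀ σ τ : F ≃ₐ[K] F, σ * τ = τ * σ) :
    ∀ (E : Type*) [Field E] [Algebra F E] [FiniteDimensional F E],
      Module.Free ℤ (Additive (Eˣ ⧸ CommGroup.torsion Eˣ)) := by
  intro E _ _ _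
  have hE0 : CharZero E := charZero_of_injective_algebraMap (algebraMap F E).injective
  have : Algebra.IsAlgebraic ℚ E := Algebra.IsAlgebraic.trans ℚ F E
  have hcE : Countable E := by
    have := Algebraic.countable ℚ E
    have h2 : {x : E | IsAlgebraic ℚ x} = Set.univ :=
      Set.eq_univ_of_forall (fun x => Algebra.IsAlgebraic.isAlgebraic x)
    rw [h2] at this
    exact Set.countable_univ_iff.1 this
  have : Countable Eˣ := Units.val_injective.countable
  let Ω := AlgebraicClosure E
  have : Algebra.IsAlgebraic ℚ Ω := Algebra.IsAlgebraic.trans ℚ E Ω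
  let φ : Eˣ →* Ωˣ := Units.map (algebraMap E Ω).toMonoidHom
  have hφ : Function.Injective φ := Units.map_injective (algebraMap E Ω).injective
  refine smf_group φ hφ ?_
  intro s hs
  let b := Module.finBasis F E
  let T : Set Ω := (fun i => algebraMap E Ω (b i)) '' Set.univ ∪
    (fun x : Eˣ => algebraMap E Ω x) '' s
  have hT : T.Finite := (Set.finite_univ.image _).union (hs.image _)
  let j : F →ₐ[ℚ] Ω := ((algebraMap E Ω).comp (algebraMap F E)).toRatAlgHom
  let L : IntermediateField ℚ Ω := IntermediateField.adjoin ℚ T ⊔ K.map j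
  have : FiniteDimensional ℚ (IntermediateField.adjoin ℚ T) := by
    have : Finite T := hT
    exact IntermediateField.finiteDimensional_adjoin
      (fun x _ => (Algebra.IsAlgebraic.isAlgebraic x).isIntegral)
  have : FiniteDimensional ℚ (K.map j) :=
    (IntermediateField.equivMap K j).toLinearEquiv.finiteDimensional
  have hLfin : FiniteDimensional ℚ L := IntermediateField.finiteDimensional_sup _ _
  have hLnf : NumberField L := ⟨⟩
  have : Algebra.IsAlgebraic L Ω := Algebra.IsAlgebraic.tower_top (K := ℚ) L
  have hTL : ∀ t ∈ T, t ∈ L := fun t ht =>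
    (le_sup_left : _ ≤ L) (IntermediateField.subset_adjoin ℚ T ht)
  have hKL : ∀ k : K, j k ∈ L := fun k => (le_sup_right : _ ≤ L) ⟨k, k.2, rfl⟩
  -- commutation
  have hcommF : ∀ (σ τ : Ω ≃ₐ[L] Ω) (y : F), σ (τ (j y)) = τ (σ (j y)) := by
    intro σ τ y
    have hj : j y = algebraMap F Ω y := (IsScalarTower.algebraMap_apply F E Ω y).symm
    rw [hj]
    refine smf_comm F K habelian Ω L ?_ σ τ y
    intro k
    refine ⟨⟨j k, hKL k⟩, ?_⟩
    exact (IsScalarTower.algebraMap_apply F E Ω k).symm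
  have hcomm : ∀ (x : E) (σ τ : Ω ≃ₐ[L] Ω),
      σ (τ (algebraMap E Ω x)) = τ (σ (algebraMap E Ω x)) := by
    intro x σ τ
    rw [← b.sum_repr x]
    simp only [map_sum, Algebra.smul_def, map_mul]
    refine Finset.sum_congr rfl (fun i _ => ?_)
    have h1 : algebraMap E Ω (b i) ∈ L := hTL _ (Or.inl ⟨i, trivial, rfl⟩)
    have h2 : ∀ σ : Ω ≃ₐ[L] Ω, σ (algebraMap E Ω (b i)) = algebraMap E Ω (b i) := fun σ =>
      σ.commutes ⟨_, h1⟩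
    rw [h2 τ, h2 σ, h2 τ]
    congr 1
    exact hcommF σ τ _
  let ι : Lˣ →* Ωˣ := Units.map (algebraMap L Ω).toMonoidHom
  have hι : Function.Injective ι := Units.map_injective (algebraMap L Ω).injective
  obtain ⟨U, hU, hsU, hUr⟩ := smf_sunits L (ι ⁻¹' (φ '' s)) ((hs.image φ).preimage hι.injOn)
  have hclos : ∀ y ∈ Subgroup.closure s, φ y ∈ U.map ι := by
    have : Subgroup.closure s ≤ (U.map ι).comap φ := by
      rw [Subgroup.closure_le]
      intro y hy
      have hyL : algebraMap E Ω y ∈ L := hTL _ (Or.inr ⟨y, hy, rfl⟩)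
      have hy0 : (⟨_, hyL⟩ : L) ≠ 0 := by
        intro h
        have h1 : algebraMap E Ω y = 0 := congrArg Subtype.val h
        exact y.ne_zero ((map_eq_zero _).1 h1)
      have hyι : ι (Units.mk0 _ hy0) = φ y := Units.ext rfl
      exact ⟨Units.mk0 _ hy0, hsU ⟨y, hy, hyι.symm⟩, hyι⟩
    exact this
  refine ⟨U.map ι, NumberField.Units.torsionOrder L, ?_, NumberField.Units.torsionOrder_ne_zero L, ?_⟩
  · exact hU.map (MonoidHom.toAdditive ι).toIntLinearMap
  · intro x m hm hxm
    obtain ⟨u, hu, hux⟩ := hclos _ hxm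
    rw [map_pow] at hux
    obtain ⟨l, k, hk, hlk⟩ := smf_key L Ω (φ x) (hcomm x) m hm ⟨u, hux.symm⟩
    refine ⟨ι l, ⟨l, ?_, rfl⟩, k, hk, hlk⟩
    refine hUr (k * m) l (mul_ne_zero hk hm) ?_
    have h1 : ι (l ^ (k * m)) = ι (u ^ (NumberField.Units.torsionOrder L * k)) := by
      rw [map_pow, map_pow, hux, pow_mul]
      change ((Units.map (algebraMap L Ω).toMonoidHom l) ^ k) ^ m = _
      rw [← hlk, ← pow_mul, ← pow_mul, ← pow_mul]
      congr 1; ring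
    rw [hι h1]
    exact pow_mem hu _
end

section
/- Let F be a countable field of characteristic 0 containing a primitive n-th root of unity for every n ≥ 1, with algebraic closure F̄, and fix an injective group homomorphism ι : μ∞ → S¹. Assume F is stably multiplicatively free, i.e. for every finite field extension E of F the group Eˣ/μ(E) (multiplicative group modulo roots of unity) is a free abelian group. Then the space X_F is path-connected. -/
noncomputable section

theorem XFaux_lift_free {A : Type*} [AddCommGroup A] [Module.Free ℤ A]
    (φ : A →+ Additive Circle) : ∃ l : A →+ ℝ, ∀ a, Circle.exp (l a) = (φ a).toMul := by
  obtain ⟨h, hh⟩ := Module.projective_lifting_property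
    (Circle.expHom.toIntLinearMap) φ.toIntLinearMap (by
      intro z
      obtain ⟨t, ht⟩ := Circle.exp_surjective z.toMul
      exact ⟨t, by simpa using congrArg Additive.ofMul ht⟩)
  refine ⟨h.toAddMonoidHom, fun a => ?_⟩
  have := congrArg Additive.toMul (LinearMap.congr_fun hh a)
  simpa using this

theorem XFaux_ext_real {A B : Type*} [AddCommGroup A] [AddCommGroup B] (i : A →+ B)
    (hi : Function.Injective i) (f : A →+ ℝ) : ∃ g : B →+ ℝ, ∀ a, g (i a) = f a := by
  let : DivisibleBy ℝ ℤ := AddCommGroup.divisibleByIntOfSMulTopEqTop ℝ (by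
    intro n hn
    refine eq_top_iff.2 fun x _ => ?_
    refine ⟨x / n, trivial, ?_⟩
    have : (n : ℝ) ≠ 0 := by exact_mod_cast hn
    simp [zsmul_eq_mul]; field_simp)
  obtain ⟨g, hg⟩ := (Module.Baer.of_divisible ℝ).extension_property_addMonoidHom i hi f
  exact ⟨g, fun a => DFunLike.congr_fun hg a⟩

theorem XFaux_ext_circle {A B : Type*} [AddCommGroup A] [AddCommGroup B] (i : A →+ B)
    (hi : Function.Injective i) (f : A →+ Additive Circle) :
    ∃ g : B →+ Additive Circle, ∀ a, g (i a) = f a := by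
  let : DivisibleBy (Additive Circle) ℤ :=
    AddCommGroup.divisibleByIntOfSMulTopEqTop (Additive Circle) (by
    intro n hn
    refine eq_top_iff.2 fun x _ => ?_
    obtain ⟨t, ht⟩ := Circle.exp_surjective x.toMul
    refine ⟨Circle.expHom (t / n), trivial, ?_⟩
    have : (n : ℝ) ≠ 0 := by exact_mod_cast hn
    change n • Circle.expHom (t / n) = x
    rw [← map_zsmul, zsmul_eq_mul, mul_div_cancel₀ _ this]
    exact congrArg Additive.ofMul ht)
  obtain ⟨g, hg⟩ := (Module.Baer.of_divisible (Additive Circle)).extension_property_addMonoidHom i hi f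
  exact ⟨g, fun a => DFunLike.congr_fun hg a⟩

theorem XFaux_card_dual (A : Type*) [CommGroup A] [Finite A] :
    Nat.card (A →* Circle) = Nat.card A := by
  have : NeZero (Monoid.exponent A) := ⟨Monoid.exponent_ne_zero_of_finite⟩
  rw [← CommGroup.card_monoidHom_of_hasEnoughRootsOfUnity A Circle]
  exact Nat.card_congr (MulEquiv.monoidHomCongrRightEquiv (toUnits (G := Circle)))

theorem XFaux_duality {G S : Type*} [Group G] [Finite G] [CommGroup S]
    (Φ : G →* (S →* Circle)) (φ : S →* Circle)
    (h : ∀ s, (∀ g, Φ g s = 1) → φ s = 1) : ∃ g, Φ g = φ := by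
  set H := Φ.range with hH
  have : Finite H := Set.finite_range Φ
  let ev : S →* (H →* Circle) := (MonoidHom.compHom' H.subtype).comp MonoidHom.eval
  have hev : ∀ s (x : H), ev s x = x.1 s := fun s x => rfl
  have hdual : ∀ (A : Type _) [CommGroup A] [Finite A], Finite (A →* Circle) := fun A _ _ =>
    Nat.finite_of_card_ne_zero (by rw [XFaux_card_dual]; exact Nat.card_pos.ne')
  have := hdual H
  let N := ev.ker
  have : Finite (S ⧸ N) := Finite.of_injective _ (QuotientGroup.kerLift_injective ev)
  have hc1 : Nat.card (S ⧸ N) ≤ Nat.card H := by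
    rw [← XFaux_card_dual H]
    exact Nat.card_le_card_of_injective _ (QuotientGroup.kerLift_injective ev)
  let T : Subgroup (S →* Circle) := 
    { carrier := {f | ∀ s ∈ N, f s = 1}
      mul_mem' := by
        intro a b ha hb s hs
        simp [ha s hs, hb s hs]
      one_mem' := by intro s hs; simp
      inv_mem' := by
        intro a ha s hs
        simp [ha s hs] }
  let j : T → (S ⧸ N →* Circle) := fun f => QuotientGroup.lift N f.1 f.2
  have hj : Function.Injective j := by
    intro f g hfg
    ext s : 2
    have := DFunLike.congr_fun hfg (QuotientGroup.mk s)
    exact this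
  have : Finite (S ⧸ N →* Circle) := 
    Nat.finite_of_card_ne_zero (by rw [XFaux_card_dual]; exact Nat.card_pos.ne')
  have : Finite T := Finite.of_injective j hj
  have hc2 : Nat.card T ≤ Nat.card H := by
    refine le_trans ?_ hc1
    rw [← XFaux_card_dual (S ⧸ N)]
    exact Nat.card_le_card_of_injective j hj
  have hHT : H ≤ T := by
    intro f hf s hs
    have : ev s = 1 := hs
    have := DFunLike.congr_fun this ⟨f, hf⟩
    simpa [hev] using this
  have hEq : H = T := Subgroup.eq_of_le_of_card_ge hHT hc2
  have : φ ∈ H := by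
    rw [hEq]
    intro s hs
    apply h
    intro g
    have h1 : ev s = 1 := hs
    have := DFunLike.congr_fun h1 ⟨Φ g, g, rfl⟩
    simpa [hev] using this
  exact this

/-- torsion units of `L` are fixed -/
theorem XFaux_fixed {K L : Type*} [Field K] [Field L] [Algebra K L]
    (hroots : ∀ n : ℕ, 0 < n → ∃ ζ : K, IsPrimitiveRoot ζ n) (τ : L ≃ₐ[K] L)
    (ζ : Lˣ) (hζ : ζ ∈ CommGroup.torsion Lˣ) : Units.map (τ : L →* L) ζ = ζ := by
  have : IsOfFinOrder ζ := hζ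
  obtain ⟨n, hn, h⟩ := isOfFinOrder_iff_pow_eq_one.1 this
  obtain ⟨z, hz⟩ := hroots n hn
  have hz' := hz.map_of_injective (algebraMap K L).injective
  have : NeZero n := ⟨hn.ne'⟩
  obtain ⟨i, -, hi⟩ := hz'.eq_pow_of_pow_eq_one (ξ := (ζ : L)) (by
    rw [← Units.val_pow_eq_pow_val, h, Units.val_one])
  ext
  simp [← hi]

theorem XFaux_step {K L : Type*} [Field K] [Field L] [Algebra K L] [FiniteDimensional K L]
    [IsGalois K L]
    (hroots : ∀ n : ℕ, 0 < n → ∃ ζ : K, IsPrimitiveRoot ζ n)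
    (hfree : Module.Free ℤ (Additive (Lˣ ⧸ CommGroup.torsion Lˣ)))
    (β ψ : Lˣ →* Circle) (hβ : ∀ ζ ∈ CommGroup.torsion Lˣ, β ζ = 1 → ζ = 1)
    (hψ : ∀ x : Lˣ, (x : L) ∈ Set.range (algebraMap K L) → ψ x = 1) :
    ∃ (τ : L ≃ₐ[K] L) (l : Additive Lˣ →+ ℝ),
      (∀ x : Lˣ, (x : L) ∈ Set.range (algebraMap K L) → l (Additive.ofMul x) = 0) ∧
      ∀ x : Lˣ, ψ x * β (Units.map (τ : L →* L) x / x) = Circle.exp (l (Additive.ofMul x)) := by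
  have hfix := XFaux_fixed (K := K) (L := L) hroots
  let d : (L ≃ₐ[K] L) → Lˣ →* Lˣ := fun τ => Units.map (τ : L →* L) / MonoidHom.id _
  have hd : ∀ τ x, d τ x = Units.map (τ : L →* L) x / x := fun τ x => rfl
  let D : Lˣ →* ((L ≃ₐ[K] L) → Lˣ ⧸ CommGroup.torsion Lˣ) :=
    MonoidHom.pi fun τ => (QuotientGroup.mk' _).comp (d τ)
  let S := D.ker
  have hS : ∀ x ∈ S, ∀ τ, d τ x ∈ CommGroup.torsion Lˣ := by
    intro x hx τ
    have : D x = 1 := hx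
    have := congrFun this τ
    exact (QuotientGroup.eq_one_iff _).1 this
  let Φ : (L ≃ₐ[K] L) →* (S →* Circle) :=
    { toFun := fun τ => (β.comp (d τ)).comp S.subtype
      map_one' := by
        ext x
        have : d 1 x = 1 := by
          rw [hd, div_eq_one]; ext; simp
        simp [this]
      map_mul' := by
        intro τ σ
        ext x
        have : d (τ * σ) x = d τ x * d σ x := by
          have h1 := hfix τ _ (hS x x.2 σ)
          rw [hd σ, map_div, ← hd] at h1
          have h2 : Units.map ((τ * σ : L ≃ₐ[K] L) : L →* L) (x : Lˣ) =
            Units.map (τ : L →* L) (Units.map (σ : L →* L) (x : Lˣ)) := by ext; simp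
          rw [hd (τ * σ), h2, ← h1, hd]
          simp
        simp [this] }
  have hΦ : ∀ τ (x : S), Φ τ x = β (d τ x) := fun _ _ => rfl
  obtain ⟨τ, hτ⟩ := XFaux_duality Φ (ψ.comp S.subtype)⁻¹ (by
    intro s hs
    have : ∀ τ : L ≃ₐ[K] L, τ ((s : Lˣ) : L) = (s : Lˣ) := by
      intro τ
      have h1 := hβ _ (hS s s.2 τ) (hs τ)
      rw [hd, div_eq_one] at h1
      simpa using congrArg Units.val h1
    have h2 := hψ s ((IsGalois.mem_range_algebraMap_iff_fixed _).2 this)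
    simp [h2])
  let ψ' : Lˣ →* Circle := ψ * β.comp (d τ)
  have hψ' : D.ker ≤ ψ'.ker := by
    intro x hx
    have := DFunLike.congr_fun hτ ⟨x, hx⟩
    rw [hΦ] at this
    simp at this
    simp [MonoidHom.mem_ker, ψ', this]
  let i : Additive (Lˣ ⧸ D.ker) →+ ((L ≃ₐ[K] L) → Additive (Lˣ ⧸ CommGroup.torsion Lˣ)) :=
    { toFun := fun x τ => Additive.ofMul (QuotientGroup.kerLift D x.toMul τ)
      map_zero' := by ext; simp
      map_add' := by intro a b; ext; simp }
  have hi : Function.Injective i := by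
    intro a b hab
    apply QuotientGroup.kerLift_injective D
    ext τ
    exact congrFun hab τ
  let f : Additive (Lˣ ⧸ D.ker) →+ Additive Circle :=
    MonoidHom.toAdditive (QuotientGroup.lift D.ker ψ' hψ')
  obtain ⟨g, hg⟩ := XFaux_ext_circle (A := Additive (Lˣ ⧸ D.ker)) i hi f
  obtain ⟨l, hl⟩ := XFaux_lift_free g
  let m : Additive Lˣ →+ ((L ≃ₐ[K] L) → Additive (Lˣ ⧸ CommGroup.torsion Lˣ)) :=
    i.comp (MonoidHom.toAdditive (QuotientGroup.mk' D.ker))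
  refine ⟨τ, l.comp m, ?_, ?_⟩
  · rintro x ⟨y, hy⟩
    have : D x = 1 := by
      ext σ
      have : d σ x = 1 := by
        rw [hd, div_eq_one]; ext; simp [← hy]
      simp [D, this]
    have h2 : m (Additive.ofMul x) = 0 := by
      ext σ
      exact congrFun this σ
    simp [h2]
  · intro x
    have := hl (m (Additive.ofMul x))
    simp only [AddMonoidHom.comp_apply] at *
    rw [this]
    simp only [m, AddMonoidHom.comp_apply]
    rw [hg]
    rfl

universe uXFa uXFb uXFc

theorem XFaux_free {F : Type uXFa} [Field F] [Countable F]
    (hsmf : ∀ (E : Type uXFc) [Field E] [Algebra F E] [FiniteDimensional F E],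
      Module.Free ℤ (Additive (Eˣ ⧸ CommGroup.torsion Eˣ)))
    (E : Type uXFb) [Field E] [Algebra F E] [FiniteDimensional F E] :
    Module.Free ℤ (Additive (Eˣ ⧸ CommGroup.torsion Eˣ)) := by
  have : Countable E := (Module.finBasis F E).equivFun.toEquiv.countable_iff.2 inferInstance
  let e : Shrink.{uXFc} E ≃ₐ[F] E := Shrink.algEquiv.{uXFc} F E
  have : FiniteDimensional F (Shrink.{uXFc} E) := Module.Finite.equiv e.symm.toLinearEquiv
  have h := hsmf (Shrink.{uXFc} E)
  let u : (Shrink.{uXFc} E)ˣ ≃* Eˣ := Units.mapEquiv (e : Shrink.{uXFc} E ≃* E)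
  have hu : (CommGroup.torsion (Shrink.{uXFc} E)ˣ).map
      (u : (Shrink.{uXFc} E)ˣ →* Eˣ) = CommGroup.torsion Eˣ := by
    ext x
    constructor
    · rintro ⟨y, hy, rfl⟩
      exact MonoidHom.isOfFinOrder _ hy
    · intro hx
      refine ⟨u.symm x, ?_, by simp⟩
      exact MonoidHom.isOfFinOrder u.symm.toMonoidHom hx
  let q := QuotientGroup.congr _ _ u hu
  exact Module.Free.of_equiv (MulEquiv.toAdditive q).toIntLinearEquiv

theorem XFaux_step2 {F Fbar : Type*} [Field F] [Field Fbar] [Algebra F Fbar] [Normal F Fbar]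
    (hroots : ∀ n : ℕ, 0 < n → ∃ ζ : F, IsPrimitiveRoot ζ n)
    (χ₀ χ₁ : Fbarˣ →* Circle)
    (hinj : ∀ ζ ∈ CommGroup.torsion Fbarˣ, χ₁ ζ = 1 → ζ = 1)
    (K L : IntermediateField F Fbar) (hKL : K ≤ L) [FiniteDimensional F L] [IsGalois F L]
    (hfree : Module.Free ℤ (Additive (Lˣ ⧸ CommGroup.torsion Lˣ)))
    (σ : Fbar ≃ₐ[F] Fbar) (l : Additive Fbarˣ →+ ℝ)
    (h : ∀ x : Fbarˣ, (x : Fbar) ∈ K →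
      χ₁ (Units.map (σ : Fbar →* Fbar) x) = χ₀ x * Circle.exp (l (Additive.ofMul x))) :
    ∃ (σ' : Fbar ≃ₐ[F] Fbar) (l' : Additive Fbarˣ →+ ℝ),
      (∀ x : Fbarˣ, (x : Fbar) ∈ L →
        χ₁ (Units.map (σ' : Fbar →* Fbar) x) = χ₀ x * Circle.exp (l' (Additive.ofMul x))) ∧
      ∀ x : Fbarˣ, (x : Fbar) ∈ K → σ' x = σ x ∧ l' (Additive.ofMul x) = l (Additive.ofMul x) := by
  algebraize [(IntermediateField.inclusion hKL).toRingHom]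
  have : IsScalarTower F K L := IsScalarTower.of_algebraMap_eq fun x => rfl
  have : FiniteDimensional K L := FiniteDimensional.right F K L
  have : IsGalois K L := IsGalois.tower_top_of_isGalois F K L
  let j : Lˣ →* Fbarˣ := Units.map (L.val : L →* Fbar)
  have hj : Function.Injective j := Units.map_injective Subtype.val_injective
  have hjv : ∀ x, ((j x : Fbarˣ) : Fbar) = ((x : L) : Fbar) := fun x => rfl
  let sg : Fbarˣ →* Fbarˣ := Units.map (σ : Fbar →* Fbar)
  have hsg : Function.Injective sg := Units.map_injective σ.injective
  let el : Fbarˣ →* Circle :=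
    { toFun := fun x => Circle.exp (l (Additive.ofMul x))
      map_one' := by simp
      map_mul' := by intro x y; simp [Circle.exp_add] }
  let β : Lˣ →* Circle := (χ₁.comp sg).comp j
  let ψ : Lˣ →* Circle := β / (χ₀ * el).comp j
  obtain ⟨τ, m, hm0, hm⟩ := XFaux_step (K := K) (L := L) (by
      intro n hn
      obtain ⟨z, hz⟩ := hroots n hn
      exact ⟨_, hz.map_of_injective (algebraMap F K).injective⟩) hfree β ψ (by
      intro ζ hζ h1
      have hζ' : sg (j ζ) ∈ CommGroup.torsion Fbarˣ :=
        MonoidHom.isOfFinOrder _ (MonoidHom.isOfFinOrder j hζ)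
      have h2 := hinj _ hζ' h1
      apply hj
      apply hsg
      simp [h2]) (by
      rintro x ⟨y, hy⟩
      have h1 := h (j x) (by
        rw [hjv, ← hy]
        exact y.2)
      have : β x = (χ₀ * el).comp j x := h1
      simp only [ψ, MonoidHom.div_apply, this, div_self'])
  obtain ⟨m', hm'⟩ := XFaux_ext_real (MonoidHom.toAdditive j) hj m
  have hm'' : ∀ x : Lˣ, m' (Additive.ofMul (j x)) = m (Additive.ofMul x) := fun x => hm' _
  let τF : L ≃ₐ[F] L := τ.restrictScalars F
  let T : Fbar ≃ₐ[F] Fbar := τF.liftNormal Fbar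
  have hT : ∀ x : L, T (x : Fbar) = (τ x : L) := fun x =>
    AlgEquiv.liftNormal_commutes τF Fbar x
  have hunit : ∀ x : Fbarˣ, (x : Fbar) ∈ L → ∃ y : Lˣ, j y = x := by
    intro x hx
    refine ⟨Units.mk0 ⟨x, hx⟩ ?_, ?_⟩
    · intro h0
      exact x.ne_zero (congrArg Subtype.val h0)
    · ext; rfl
  refine ⟨T.trans σ, l + m', ?_, ?_⟩
  · intro x hx
    obtain ⟨y, rfl⟩ := hunit x hx
    have h1 := hm y
    have h2 : Units.map ((T.trans σ : Fbar ≃ₐ[F] Fbar) : Fbar →* Fbar) (j y)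
        = sg (j (Units.map (τ : L →* L) y)) := by
      ext
      change σ (T (y : L)) = σ ((τ y : L) : Fbar)
      rw [hT]
    rw [h2, AddMonoidHom.add_apply, Circle.exp_add, hm'', ← h1, map_div]
    have e1 : χ₁ (sg (j (Units.map (τ : L →* L) y))) = β (Units.map (τ : L →* L) y) := rfl
    have e2 : ψ y = β y / (χ₀ (j y) * Circle.exp (l (Additive.ofMul (j y)))) := rfl
    rw [e1, e2, ← mul_assoc]
    simp
  · intro x hx
    obtain ⟨y, rfl⟩ := hunit x (hKL hx)
    have hy : ((y : L)) = algebraMap K L ⟨(y : L), hx⟩ := rfl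
    constructor
    · change σ (T (y : L)) = σ (y : L)
      rw [hT, hy, AlgEquiv.commutes]
    · rw [AddMonoidHom.add_apply, hm'', hm0 y ⟨_, hy.symm⟩, add_zero]

theorem XFaux_key {F Fbar : Type*} [Field F] [Field Fbar] [Algebra F Fbar] [IsGalois F Fbar]
    [Countable Fbar]
    (hroots : ∀ n : ℕ, 0 < n → ∃ ζ : F, IsPrimitiveRoot ζ n)
    (hfree : ∀ L : IntermediateField F Fbar, FiniteDimensional F L →
      Module.Free ℤ (Additive (Lˣ ⧸ CommGroup.torsion Lˣ)))
    (χ₀ χ₁ : Fbarˣ →* Circle)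
    (hinj : ∀ ζ ∈ CommGroup.torsion Fbarˣ, χ₁ ζ = 1 → ζ = 1)
    (hagree : ∀ ζ ∈ CommGroup.torsion Fbarˣ, χ₁ ζ = χ₀ ζ) :
    ∃ (σ : Fbar ≃ₐ[F] Fbar) (l : Additive Fbarˣ →+ ℝ), ∀ x : Fbarˣ,
      χ₁ (Units.map (σ : Fbar →* Fbar) x) = χ₀ x * Circle.exp (l (Additive.ofMul x)) := by
  obtain ⟨en, hen⟩ := exists_surjective_nat Fbar
  let E : ℕ → FiniteGaloisIntermediateField F Fbar := fun n =>
    Nat.rec ⊥ (fun k M => M ⊔ FiniteGaloisIntermediateField.adjoin F {en k}) n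
  have hE : ∀ n, E (n + 1) = E n ⊔ FiniteGaloisIntermediateField.adjoin F {en n} := fun n => rfl
  have hEs : ∀ n, E n ≤ E (n + 1) := fun n => by rw [hE]; exact le_sup_left
  have hEm : Monotone E := monotone_nat_of_le_succ hEs
  have hmem : ∀ x : Fbar, ∃ n, x ∈ (E n).toIntermediateField := by
    intro x
    obtain ⟨n, rfl⟩ := hen x
    refine ⟨n + 1, ?_⟩
    rw [← FiniteGaloisIntermediateField.adjoin_simple_le_iff, hE]
    exact le_sup_right
  let P : ℕ → (Fbar ≃ₐ[F] Fbar) × (Additive Fbarˣ →+ ℝ) → Prop := fun n p =>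
    ∀ x : Fbarˣ, (x : Fbar) ∈ (E n).toIntermediateField →
      χ₁ (Units.map (p.1 : Fbar →* Fbar) x) = χ₀ x * Circle.exp (p.2 (Additive.ofMul x))
  have hstep : ∀ n (p : {p // P n p}), ∃ q : {p // P (n + 1) p},
      ∀ x : Fbarˣ, (x : Fbar) ∈ (E n).toIntermediateField →
        q.1.1 x = p.1.1 x ∧ q.1.2 (Additive.ofMul x) = p.1.2 (Additive.ofMul x) := by
    rintro n ⟨⟨σ, l⟩, hp⟩
    obtain ⟨σ', l', h1, h2⟩ := XFaux_step2 hroots χ₀ χ₁ hinj (E n).toIntermediateField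
      (E (n + 1)).toIntermediateField (hEs n) (hfree _ inferInstance) σ l hp
    exact ⟨⟨(σ', l'), h1⟩, h2⟩
  have hbase : ∃ p, P 0 p := by
    let L := (E 0).toIntermediateField
    have := hfree L (E 0).finiteDimensional
    let j : Lˣ →* Fbarˣ := Units.map (L.val : L →* Fbar)
    have hj : Function.Injective j := Units.map_injective Subtype.val_injective
    let φ : Lˣ →* Circle := (χ₁ / χ₀).comp j
    have hφ : CommGroup.torsion Lˣ ≤ φ.ker := by
      intro ζ hζ
      have := hagree (j ζ) (MonoidHom.isOfFinOrder j hζ)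
      simp [MonoidHom.mem_ker, φ, this]
    let f : Additive (Lˣ ⧸ CommGroup.torsion Lˣ) →+ Additive Circle :=
      MonoidHom.toAdditive (QuotientGroup.lift _ φ hφ)
    obtain ⟨m, hm⟩ := XFaux_lift_free (A := Additive (Lˣ ⧸ CommGroup.torsion Lˣ)) f
    let mL : Additive Lˣ →+ ℝ :=
      m.comp (MonoidHom.toAdditive (QuotientGroup.mk' (CommGroup.torsion Lˣ)))
    obtain ⟨l, hl⟩ := XFaux_ext_real (MonoidHom.toAdditive j) hj mL
    refine ⟨(1, l), ?_⟩
    intro x hx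
    obtain ⟨y, rfl⟩ : ∃ y : Lˣ, j y = x := by
      refine ⟨Units.mk0 ⟨x, hx⟩ ?_, ?_⟩
      · intro h0
        exact x.ne_zero (congrArg Subtype.val h0)
      · ext; rfl
    have e1 : Units.map ((1 : Fbar ≃ₐ[F] Fbar) : Fbar →* Fbar) (j y) = j y := by ext; simp
    have e2 : l (Additive.ofMul (j y)) = mL (Additive.ofMul y) := hl _
    have e3 : Circle.exp (mL (Additive.ofMul y)) = χ₁ (j y) / χ₀ (j y) :=
      hm (Additive.ofMul (QuotientGroup.mk y))
    change χ₁ (Units.map ((1 : Fbar ≃ₐ[F] Fbar) : Fbar →* Fbar) (j y)) =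
      χ₀ (j y) * Circle.exp (l (Additive.ofMul (j y)))
    rw [e1, e2, e3]
    simp
  choose nx hnx using hstep
  let st : ∀ n, {p // P n p} := fun n => Nat.rec ⟨_, hbase.choose_spec⟩ (fun k p => nx k p) n
  have hst : ∀ n, st (n + 1) = nx n (st n) := fun n => rfl
  have hcompat : ∀ n m, n ≤ m → ∀ x : Fbarˣ, (x : Fbar) ∈ (E n).toIntermediateField →
      (st m).1.1 x = (st n).1.1 x ∧
        (st m).1.2 (Additive.ofMul x) = (st n).1.2 (Additive.ofMul x) := by
    intro n m hnm x hx
    induction m, hnm using Nat.le_induction with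
    | base => exact ⟨rfl, rfl⟩
    | succ m hnm ih =>
      have := hnx m (st m) x (hEm hnm hx)
      rw [hst]
      exact ⟨this.1.trans ih.1, this.2.trans ih.2⟩
  choose N hN using hmem
  have hcσ : ∀ n (x : Fbar), x ∈ (E n).toIntermediateField → (st (N x)).1.1 x = (st n).1.1 x := by
    intro n x hx
    by_cases h0 : x = 0
    · simp [h0]
    · let u := Units.mk0 x h0
      have h1 := (hcompat n (max n (N x)) (le_max_left _ _) u hx).1
      have h2 := (hcompat (N x) (max n (N x)) (le_max_right _ _) u (hN x)).1
      exact h2.symm.trans h1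
  have hcl : ∀ n (x : Fbarˣ), (x : Fbar) ∈ (E n).toIntermediateField →
      (st (N x)).1.2 (Additive.ofMul x) = (st n).1.2 (Additive.ofMul x) := by
    intro n x hx
    have h1 := (hcompat n (max n (N x)) (le_max_left _ _) x hx).2
    have h2 := (hcompat (N x) (max n (N x)) (le_max_right _ _) x (hN x)).2
    exact h2.symm.trans h1
  have hup : ∀ x : Fbar, ∀ n, N x ≤ n → x ∈ (E n).toIntermediateField :=
    fun x n hn => hEm hn (hN x)
  let s : Fbar →ₐ[F] Fbar :=
    { toFun := fun x => (st (N x)).1.1 x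
      map_one' := by simp
      map_zero' := by simp
      map_mul' := by
        intro x y
        have hx := hup x (max (N x) (N y)) (le_max_left _ _)
        have hy := hup y (max (N x) (N y)) (le_max_right _ _)
        rw [hcσ _ x hx, hcσ _ y hy, hcσ _ (x * y) (mul_mem hx hy), map_mul]
      map_add' := by
        intro x y
        have hx := hup x (max (N x) (N y)) (le_max_left _ _)
        have hy := hup y (max (N x) (N y)) (le_max_right _ _)
        rw [hcσ _ x hx, hcσ _ y hy, hcσ _ (x + y) (add_mem hx hy), map_add]
      commutes' := by intro r; simp }
  let σ : Fbar ≃ₐ[F] Fbar := AlgEquiv.ofBijective s (Algebra.IsAlgebraic.algHom_bijective s)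
  have hσ : ∀ x, σ x = (st (N x)).1.1 x := fun x => rfl
  let l : Additive Fbarˣ →+ ℝ :=
    { toFun := fun x => (st (N (x.toMul : Fbarˣ))).1.2 x
      map_zero' := by simp
      map_add' := by
        intro x y
        have hx := hup (x.toMul : Fbarˣ) (max (N (x.toMul : Fbarˣ)) (N (y.toMul : Fbarˣ)))
          (le_max_left _ _)
        have hy := hup (y.toMul : Fbarˣ) (max (N (x.toMul : Fbarˣ)) (N (y.toMul : Fbarˣ)))
          (le_max_right _ _)
        have e1 := hcl _ x.toMul hx
        have e2 := hcl _ y.toMul hy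
        have e3 := hcl _ (x.toMul * y.toMul) (by
          rw [Units.val_mul]
          exact mul_mem hx hy)
        refine e3.trans ?_
        rw [ofMul_mul, map_add, ← e1, ← e2]
        rfl }
  refine ⟨σ, l, fun x => ?_⟩
  have := (st (N x)).2 x (hN x)
  have e : Units.map (σ : Fbar →* Fbar) x =
      Units.map ((st (N x)).1.1 : Fbar →* Fbar) x := by
    ext; rfl
  rw [e, this]
  rfl

/-- Let `F` be a countable field of characteristic `0` containing all roots of unity
which is stably multiplicatively free (for every finite extension `E` of `F`, the group
`Eˣ` modulo roots of unity is free abelian).  Then `X_F` is path-connected. -/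
theorem XF_pathConnected (F Fbar : Type*) [Field F] [CharZero F] [Countable F]
    [Field Fbar] [Algebra F Fbar] [IsAlgClosure F Fbar]
    (hroots : ∀ n : ℕ, 0 < n → ∃ ζ : F, IsPrimitiveRoot ζ n)
    (ι : (CommGroup.torsion Fbarˣ) →* Circle) (hι : Function.Injective ι)
    (hsmf : ∀ (E : Type*) [Field E] [Algebra F E] [FiniteDimensional F E],
      Module.Free ℤ (Additive (Eˣ ⧸ CommGroup.torsion Eˣ))) :
    PathConnectedSpace (XF F Fbar ι) := by
  have hcount : Countable Fbar := by
    have h := Algebraic.countable F Fbar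
    have h2 : {x : Fbar | IsAlgebraic F x} = Set.univ :=
      Set.eq_univ_of_forall fun x =>
        (IsAlgClosure.isAlgebraic (R := F) (K := Fbar)).isAlgebraic x
    rw [h2] at h
    exact Set.countable_univ_iff.1 h
  have hgal : IsGalois F Fbar := inferInstance
  have hkey := XFaux_key (F := F) (Fbar := Fbar) hroots
    (fun L _ => XFaux_free hsmf L)
  have hex : ∃ χ : Fbarˣ →* Circle, ∀ ζ : CommGroup.torsion Fbarˣ, χ ζ = ι ζ := by
    obtain ⟨g, hg⟩ := XFaux_ext_circle
      (MonoidHom.toAdditive (CommGroup.torsion Fbarˣ).subtype) Subtype.val_injective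
      (MonoidHom.toAdditive ι)
    exact ⟨MonoidHom.toAdditive.symm g, fun ζ => congrArg Additive.toMul (hg (Additive.ofMul ζ))⟩
  refine ⟨⟨Quotient.mk _ ⟨hex.choose, hex.choose_spec⟩⟩, ?_⟩
  intro a b
  induction a using Quotient.inductionOn with | _ χ₀ => ?_
  induction b using Quotient.inductionOn with | _ χ₁ => ?_
  obtain ⟨σ, l, h⟩ := hkey χ₀.1 χ₁.1
    (fun ζ hζ h1 => by
      have h2 := χ₁.2 ⟨ζ, hζ⟩
      have h3 : ι ⟨ζ, hζ⟩ = ι 1 := by rw [← h2, map_one]; exact h1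
      exact congrArg Subtype.val (hι h3))
    (fun ζ hζ => (χ₁.2 ⟨ζ, hζ⟩).trans (χ₀.2 ⟨ζ, hζ⟩).symm)
  let c : ℝ → (Fbarˣ →* Circle) := fun t =>
    { toFun := fun x => χ₀.1 x * Circle.exp (t * l (Additive.ofMul x))
      map_one' := by simp
      map_mul' := by
        intro x y
        rw [ofMul_mul, map_add, mul_add, Circle.exp_add, map_mul]
        exact mul_mul_mul_comm _ _ _ _ }
  have hc : ∀ t x, c t x = χ₀.1 x * Circle.exp (t * l (Additive.ofMul x)) := fun _ _ => rfl
  have htors : ∀ ζ ∈ CommGroup.torsion Fbarˣ, l (Additive.ofMul ζ) = 0 := by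
    intro ζ hζ
    obtain ⟨n, hn, h1⟩ := isOfFinOrder_iff_pow_eq_one.1 (show IsOfFinOrder ζ from hζ)
    have h2 : n • l (Additive.ofMul ζ) = 0 := by
      rw [← map_nsmul, ← ofMul_pow, h1, ofMul_one, map_zero]
    rcases smul_eq_zero.1 h2 with h3 | h3
    · omega
    · exact h3
  let γ : ℝ → XChar Fbar ι := fun t => ⟨c t, fun ζ => by
    rw [hc, htors _ ζ.2, mul_zero, Circle.exp_zero, mul_one]
    exact χ₀.2 ζ⟩
  have hγ : Continuous γ := by
    refine Continuous.subtype_mk ?_ _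
    refine continuous_induced_rng.2 ?_
    refine continuous_pi fun x => ?_
    change Continuous fun t : ℝ => χ₀.1 x * Circle.exp (t * l (Additive.ofMul x))
    fun_prop
  have h0 : γ 0 = χ₀ := by
    apply Subtype.ext
    ext x : 1
    change c 0 x = _
    rw [hc]
    simp
  have h1 : (Quotient.mk (galSetoid F Fbar ι) (γ 1)) = Quotient.mk _ χ₁ := by
    refine (Quotient.sound ?_).symm
    refine ⟨σ, fun x => ?_⟩
    change c 1 x = _
    rw [hc, h, one_mul]
  have hq : Continuous (fun t : ℝ => (Quotient.mk (galSetoid F Fbar ι) (γ t) : XF F Fbar ι)) :=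
    continuous_quotient_mk'.comp hγ
  exact ⟨{ toFun := fun t => (Quotient.mk (galSetoid F Fbar ι) (γ t) : XF F Fbar ι)
           continuous_toFun := hq.comp continuous_subtype_val
           source' := by
             change Quotient.mk (galSetoid F Fbar ι) (γ 0) = _
             rw [h0]
           target' := h1 }⟩

end
end
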